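/- arXiv:2305.11062 — 3 statements merged into one kernel-verified Lean document; each statement's English description precedes it below -/
import Mathlib

section
/- Let G be an abelian group with no elements of order 2. Then the ℤ-module V(G) coincides with the ℤ-submodule of ℤ^G generated by the functions μ_{{g}} − μ_{{−g}} for g ∈ G, together with the functions μ_{ι(αU_n)} − μ_{ι(βU_n)} for n ≥ 3 odd, α, β ∈ (ℤ/nℤ)^×, and ι : ℤ/nℤ → G an injective group homomorphism. -/
open scoped BigOperators

/-- `μ : G → ℤ` belongs to `V(G)`. -/
def memV {G : Type*} [AddCommGroup G] (μ : G → ℤ) : Prop :=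
  (Function.support μ).Finite ∧
  (∀ g : G, μ g + μ (-g) = μ (g + g) + μ (-(g + g))) ∧
  (∀ H : AddSubgroup G, ∑ᶠ g ∈ (H : Set G), μ g = 0)

/-- The minimal `k ≥ 1` such that `2^k ≡ ±1 (mod n)`. -/
noncomputable def Upow (n : ℕ) : ℕ :=
  sInf {k : ℕ | 1 ≤ k ∧ ((2 : ZMod n) ^ k = 1 ∨ (2 : ZMod n) ^ k = -1)}

/-- The set `U_n = {1, 2, 4, …, 2^{k-1}} ⊆ ℤ/nℤ`. -/
noncomputable def Uset (n : ℕ) : Finset (ZMod n) :=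
  (Finset.range (Upow n)).image (fun i => (2 : ZMod n) ^ i)

section Orbits

variable {G : Type*} [AddCommGroup G]

/-- The set `{y, 2y, …, 2^{k-1}y}`. -/
def doublingSet (k : ℕ) (y : G) : Set G :=
  {x | ∃ i < k, x = 2 ^ i • y}

/-- `k` is the least positive exponent with `2^k y = ±y`, and `y ≠ -y`. -/
structure IsDoublingPeriod (k : ℕ) (y : G) : Prop where
  pos : 1 ≤ k
  period : 2 ^ k • y = y ∨ 2 ^ k • y = -y
  ne_neg : ∀ j < k, 2 ^ j • y ≠ -y
  ne_self : ∀ j < k, 1 ≤ j → 2 ^ j • y ≠ y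

theorem add_self_injective (h2 : ∀ g : G, g + g = 0 → g = 0) {x y : G} (h : x + x = y + y) :
    x = y := by
  have : (x - y) + (x - y) = 0 := by
    rw [sub_add_sub_comm, h, sub_self]
  exact sub_eq_zero.mp (h2 _ this)

theorem two_pow_succ_nsmul (i : ℕ) (y : G) : 2 ^ (i + 1) • y = 2 ^ i • y + 2 ^ i • y := by
  rw [pow_succ, mul_two, add_nsmul]

theorem two_pow_nsmul_injective (h2 : ∀ g : G, g + g = 0 → g = 0) (i : ℕ) {x y : G}
    (h : 2 ^ i • x = 2 ^ i • y) : x = y := by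
  induction i with
  | zero => simpa using h
  | succ i ih =>
    rw [two_pow_succ_nsmul, two_pow_succ_nsmul] at h
    exact ih (add_self_injective h2 h)

theorem doublingSet_finite (k : ℕ) (y : G) : (doublingSet k y).Finite := by
  refine ((Finset.range k).finite_toSet.image fun i => 2 ^ i • y).subset ?_
  rintro x ⟨i, hi, rfl⟩
  exact ⟨i, by simpa using hi, rfl⟩

variable {k : ℕ} {y : G}

theorem IsDoublingPeriod.neg_notMem (h2 : ∀ g : G, g + g = 0 → g = 0)
    (hy : IsDoublingPeriod k y) {x : G} (hx : x ∈ doublingSet k y) : -x ∉ doublingSet k y := by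
  rintro ⟨j, hj, hxj⟩
  obtain ⟨i, hi, rfl⟩ := hx
  rcases le_total i j with h | h
  · obtain ⟨d, rfl⟩ := Nat.exists_eq_add_of_le h
    rw [pow_add, mul_nsmul', ← smul_neg] at hxj
    exact hy.ne_neg d (by omega) (two_pow_nsmul_injective h2 i hxj).symm
  · obtain ⟨d, rfl⟩ := Nat.exists_eq_add_of_le h
    rw [neg_eq_iff_eq_neg, pow_add, mul_nsmul', ← smul_neg] at hxj
    exact hy.ne_neg d (by omega) (two_pow_nsmul_injective h2 j hxj)

theorem IsDoublingPeriod.mem_or_neg_mem_add_self_iff (h2 : ∀ g : G, g + g = 0 → g = 0)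
    (hy : IsDoublingPeriod k y) (x : G) :
    (x + x ∈ doublingSet k y ∨ -(x + x) ∈ doublingSet k y) ↔
      (x ∈ doublingSet k y ∨ -x ∈ doublingSet k y) := by
  have forward : ∀ x : G, x ∈ doublingSet k y →
      (x + x ∈ doublingSet k y ∨ -(x + x) ∈ doublingSet k y) := by
    rintro x ⟨i, hi, rfl⟩
    rw [← two_pow_succ_nsmul]
    rcases Nat.lt_or_ge (i + 1) k with h | h
    · exact Or.inl ⟨_, h, rfl⟩
    · obtain rfl : k = i + 1 := by omega
      rcases hy.period with h | h
      · exact Or.inl ⟨0, by omega, by simpa using h⟩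
      · exact Or.inr ⟨0, by omega, by simp [h]⟩
  have backward : ∀ x : G, x + x ∈ doublingSet k y →
      (x ∈ doublingSet k y ∨ -x ∈ doublingSet k y) := by
    rintro x ⟨i, hi, hx⟩
    rcases i with _ | i
    · obtain ⟨l, rfl⟩ := Nat.exists_eq_add_of_le' hy.pos
      have hy' := hy.period
      rw [two_pow_succ_nsmul] at hy'
      rw [pow_zero, one_nsmul] at hx
      rcases hy' with h | h
      · exact Or.inl ⟨l, by omega, add_self_injective h2 (hx.trans h.symm)⟩
      · refine Or.inr ⟨l, by omega, add_self_injective h2 ?_⟩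
        rw [h, ← hx, neg_add]
    · rw [two_pow_succ_nsmul] at hx
      exact Or.inl ⟨i, by omega, add_self_injective h2 hx⟩
  constructor
  · rintro (h | h)
    · exact backward x h
    · rw [neg_add] at h
      simpa [or_comm] using backward _ h
  · rintro (h | h)
    · exact forward x h
    · have := forward _ h
      rw [← neg_add, neg_neg] at this
      exact this.symm

open Classical in
theorem IsDoublingPeriod.indicator_add_indicator_neg (h2 : ∀ g : G, g + g = 0 → g = 0)
    (hy : IsDoublingPeriod k y) (x : G) :
    (doublingSet k y).indicator (1 : G → ℤ) x + (doublingSet k y).indicator (1 : G → ℤ) (-x) =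
      if x ∈ doublingSet k y ∨ -x ∈ doublingSet k y then 1 else 0 := by
  by_cases h : x ∈ doublingSet k y
  · simp [h, hy.neg_notMem h2 h]
  · by_cases h' : -x ∈ doublingSet k y <;> simp [h, h']

theorem IsDoublingPeriod.finsum_mem_indicator (h2 : ∀ g : G, g + g = 0 → g = 0)
    (hy : IsDoublingPeriod k y) (H : AddSubgroup G) [Decidable (y ∈ H)] :
    ∑ᶠ g ∈ (H : Set G), (doublingSet k y).indicator (1 : G → ℤ) g =
      if y ∈ H then (k : ℤ) else 0 := by
  split_ifs with hH
  · have hsub : doublingSet k y ⊆ H := by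
      rintro x ⟨i, -, rfl⟩
      exact H.nsmul_mem hH _
    have himage : doublingSet k y = (fun i : ℕ => 2 ^ i • y) '' (Finset.range k : Set ℕ) := by
      ext x
      simp [doublingSet, eq_comm]
    have hinj : Set.InjOn (fun i : ℕ => 2 ^ i • y) (Finset.range k : Set ℕ) := by
      have key : ∀ i j : ℕ, i < j → j < k → 2 ^ i • y ≠ 2 ^ j • y := by
        intro i j hij hj h
        obtain ⟨d, rfl⟩ := Nat.exists_eq_add_of_lt hij
        rw [add_assoc, pow_add, mul_nsmul'] at h
        exact hy.ne_self (d + 1) (by omega) (by omega) (two_pow_nsmul_injective h2 i h).symm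
      intro i hi j hj h
      simp only [Finset.coe_range, Set.mem_Iio] at hi hj
      rcases lt_trichotomy i j with hij | hij | hij
      · exact (key i j hij hj h).elim
      · exact hij
      · exact (key j i hij hi h.symm).elim
    rw [← finsum_mem_inter_support]
    have hs : (H : Set G) ∩ Function.support ((doublingSet k y).indicator (1 : G → ℤ)) =
        doublingSet k y := by
      ext x
      simp only [Set.mem_inter_iff, Function.mem_support]
      constructor
      · rintro ⟨-, h⟩
        by_contra hx
        simp [hx] at h
      · intro hx
        exact ⟨hsub hx, by simp [hx]⟩
    rw [hs, finsum_mem_congr (g := fun _ => (1 : ℤ)) rfl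
      (fun x hx => by simp [Set.indicator_of_mem hx]), himage, finsum_mem_image hinj,
      finsum_mem_coe_finset]
    simp
  · refine finsum_mem_eq_zero_of_forall_eq_zero fun x hx => ?_
    refine Set.indicator_of_notMem ?_ _
    rintro ⟨i, hi, rfl⟩
    obtain ⟨d, rfl⟩ := Nat.exists_eq_add_of_lt hi
    have hmem : 2 ^ (i + d + 1) • y ∈ H := by
      rw [add_assoc, pow_add, mul_nsmul]
      exact H.nsmul_mem hx _
    rcases hy.period with h | h
    · exact hH (h ▸ hmem)
    · exact hH (by simpa [h] using hmem)

theorem finsum_mem_sub_of_finite {α : Type*} {s : Set α} {f g : α → ℤ}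
    (hf : (s ∩ Function.support f).Finite) (hg : (s ∩ Function.support g).Finite) :
    ∑ᶠ x ∈ s, (f x - g x) = ∑ᶠ x ∈ s, f x - ∑ᶠ x ∈ s, g x := by
  have hfg : (s ∩ Function.support fun x => f x - g x).Finite := by
    refine (hf.union hg).subset ?_
    rw [← Set.inter_union_distrib_left]
    exact Set.inter_subset_inter_right _ (Function.support_sub _ _)
  rw [eq_sub_iff_add_eq, ← finsum_mem_add_distrib' hfg hg]
  simp

theorem memV_indicator_sub_indicator (h2 : ∀ g : G, g + g = 0 → g = 0) {z : G}
    (hy : IsDoublingPeriod k y) (hz : IsDoublingPeriod k z)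
    (hyz : ∀ H : AddSubgroup G, y ∈ H ↔ z ∈ H) :
    memV ((doublingSet k y).indicator (1 : G → ℤ) - (doublingSet k z).indicator (1 : G → ℤ)) := by
  classical
  have hfin : ∀ w : G,
      (Function.support ((doublingSet k w).indicator (1 : G → ℤ))).Finite := fun w =>
    (doublingSet_finite k w).subset Set.support_indicator_subset
  refine ⟨((hfin y).union (hfin z)).subset (Function.support_sub _ _), fun g => ?_, fun H => ?_⟩
  · have e1 := hy.indicator_add_indicator_neg h2 g
    have e2 := hz.indicator_add_indicator_neg h2 g
    have e3 := hy.indicator_add_indicator_neg h2 (g + g)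
    have e4 := hz.indicator_add_indicator_neg h2 (g + g)
    simp only [hy.mem_or_neg_mem_add_self_iff h2] at e3
    simp only [hz.mem_or_neg_mem_add_self_iff h2] at e4
    simp only [Pi.sub_apply]
    linarith
  · simp only [Pi.sub_apply]
    rw [finsum_mem_sub_of_finite ((hfin y).inter_of_right _) ((hfin z).inter_of_right _),
      hy.finsum_mem_indicator h2, hz.finsum_mem_indicator h2]
    simp [hyz H]

theorem memV_zero : memV (0 : G → ℤ) := by
  refine ⟨by simp, by simp, by simp⟩

theorem memV.add {μ ν : G → ℤ} (hμ : memV μ) (hν : memV ν) : memV (μ + ν) := by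
  refine ⟨(hμ.1.union hν.1).subset (Function.support_add _ _), fun g => ?_, fun H => ?_⟩
  · have := hμ.2.1 g
    have := hν.2.1 g
    simp only [Pi.add_apply]
    linarith
  · simp only [Pi.add_apply]
    rw [finsum_mem_add_distrib' (hμ.1.inter_of_right _) (hν.1.inter_of_right _), hμ.2.2 H,
      hν.2.2 H, add_zero]

theorem memV.smul {μ : G → ℤ} (hμ : memV μ) (c : ℤ) : memV (c • μ) := by
  refine ⟨hμ.1.subset (Function.support_const_smul_subset _ _), fun g => ?_, fun H => ?_⟩
  · simp only [Pi.smul_apply, smul_eq_mul]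
    rw [← mul_add, ← mul_add, hμ.2.1 g]
  · simp only [Pi.smul_apply, smul_eq_mul]
    rw [← mul_finsum_mem, hμ.2.2 H, mul_zero]

theorem indicator_singleton_sub_add_neg (g x : G) :
    (({g} : Set G).indicator (1 : G → ℤ) - ({-g} : Set G).indicator (1 : G → ℤ)) x +
      (({g} : Set G).indicator (1 : G → ℤ) - ({-g} : Set G).indicator (1 : G → ℤ)) (-x) = 0 := by
  classical
  simp only [Pi.sub_apply, Set.indicator_apply, Set.mem_singleton_iff,
    neg_eq_iff_eq_neg, neg_neg, Pi.one_apply]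
  ring

theorem memV_indicator_singleton_sub (g : G) :
    memV (({g} : Set G).indicator (1 : G → ℤ) - ({-g} : Set G).indicator (1 : G → ℤ)) := by
  classical
  have hfin : ∀ w : G, (Function.support (({w} : Set G).indicator (1 : G → ℤ))).Finite :=
    fun w => (Set.finite_singleton w).subset Set.support_indicator_subset
  have hsum : ∀ (H : AddSubgroup G) (w : G),
      ∑ᶠ x ∈ (H : Set G), ({w} : Set G).indicator (1 : G → ℤ) x = if w ∈ H then 1 else 0 := by
    intro H w
    rw [finsum_mem_def, finsum_eq_single _ w]
    · simp [Set.indicator_apply]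
    · intro x hx
      simp [hx]
  refine ⟨((hfin g).union (hfin (-g))).subset (Function.support_sub _ _), fun x => ?_,
    fun H => ?_⟩
  · rw [indicator_singleton_sub_add_neg, indicator_singleton_sub_add_neg]
  · simp only [Pi.sub_apply]
    rw [finsum_mem_sub_of_finite ((hfin g).inter_of_right _) ((hfin (-g)).inter_of_right _),
      hsum, hsum]
    simp

theorem odd_function_mem_submodule (N : Submodule ℤ (G → ℤ))
    (hN : ∀ g : G, ({g} : Set G).indicator (1 : G → ℤ) - ({-g} : Set G).indicator (1 : G → ℤ) ∈ N)
    (μ : G → ℤ) (hfin : (Function.support μ).Finite) (hodd : ∀ g, μ g + μ (-g) = 0) :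
    μ ∈ N := by
  classical
  induction hn : (Function.support μ).ncard using Nat.strong_induction_on generalizing μ with
  | _ n ih =>
  by_cases h0 : μ = 0
  · rw [h0]
    exact N.zero_mem
  obtain ⟨g, hg⟩ := Function.ne_iff.mp h0
  simp only [Pi.zero_apply] at hg
  have hgg : g ≠ -g := by
    intro h
    have := hodd g
    rw [← h] at this
    omega
  set f : G → ℤ := ({g} : Set G).indicator (1 : G → ℤ) - ({-g} : Set G).indicator (1 : G → ℤ)
    with hf
  have hfodd : ∀ x, f x + f (-x) = 0 := indicator_singleton_sub_add_neg g
  have hsub : Function.support (μ - μ g • f) ⊆ Function.support μ \ {g} := by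
    intro x hx
    simp only [Function.mem_support, Pi.sub_apply, Pi.smul_apply, smul_eq_mul] at hx
    have hxg : x ≠ g := by
      rintro rfl
      apply hx
      simp [hf, hgg]
    refine ⟨?_, hxg⟩
    intro hx0
    by_cases hxg' : x = -g
    · have := hodd g
      rw [← hxg', hx0] at this
      omega
    · apply hx
      simp [hf, hxg, hxg', hx0]
  have hlt : (Function.support (μ - μ g • f)).ncard < n := by
    rw [← hn]
    refine Set.ncard_lt_ncard ⟨hsub.trans Set.sdiff_subset, fun h => ?_⟩ hfin
    exact (hsub (h (show g ∈ Function.support μ from hg))).2 rfl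
  have hrec := ih _ hlt (μ - μ g • f) (hfin.subset (hsub.trans Set.sdiff_subset))
    (fun x => by
      simp only [Pi.sub_apply, Pi.smul_apply, smul_eq_mul]
      linear_combination hodd x - μ g * hfodd x) rfl
  have := N.add_mem hrec (N.smul_mem (μ g) (hN g))
  rwa [sub_add_cancel] at this

theorem addOrderOf_pos_of_doubling_finite {s : Set G}
    (hs : s.Finite) {g : G} (hg : ∀ i : ℕ, 2 ^ i • g ∈ s) : 0 < addOrderOf g := by
  by_contra hpos
  refine Set.infinite_of_injective_forall_mem (f := fun i : ℕ => 2 ^ i • g) ?_ hg hs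
  have hinj : Function.Injective fun n : ℕ => n • g := by
    rw [injective_nsmul_iff_not_isOfFinAddOrder, ← addOrderOf_pos_iff]
    exact hpos
  exact hinj.comp (Nat.pow_right_injective le_rfl)

theorem odd_addOrderOf (h2 : ∀ g : G, g + g = 0 → g = 0) {g : G} (hg : 0 < addOrderOf g) :
    Odd (addOrderOf g) := by
  by_contra hodd
  obtain ⟨m, hm⟩ := Nat.not_odd_iff_even.mp hodd
  have h : m • g = 0 := h2 _ (by rw [← add_nsmul, ← hm, addOrderOf_nsmul_eq_zero])
  have := Nat.le_of_dvd (by omega) (addOrderOf_dvd_of_nsmul_eq_zero h)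
  omega

end Orbits

section ZModOrbits

variable {G : Type*} [AddCommGroup G] {n : ℕ}

theorem image_mul_Uset (ι : ZMod n →+ G) (a : ZMod n) :
    ⇑ι '' ((fun u => a * u) '' (Uset n : Set (ZMod n))) = doublingSet (Upow n) (ι a) := by
  have h : ∀ i : ℕ, ι (a * 2 ^ i) = 2 ^ i • ι a := by
    intro i
    rw [← map_nsmul, nsmul_eq_mul, mul_comm]
    push_cast
    rfl
  ext x
  simp [Uset, doublingSet, h, eq_comm]

theorem Upow_spec (hn : Odd n) :
    1 ≤ Upow n ∧ ((2 : ZMod n) ^ Upow n = 1 ∨ (2 : ZMod n) ^ Upow n = -1) := by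
  refine Nat.sInf_mem
    (s := {k : ℕ | 1 ≤ k ∧ ((2 : ZMod n) ^ k = 1 ∨ (2 : ZMod n) ^ k = -1)}) ⟨n.totient, ?_, ?_⟩
  · exact Nat.totient_pos.mpr hn.pos
  · left
    have h := ZMod.pow_totient (ZMod.unitOfCoprime 2 hn.coprime_two_left)
    simpa only [Units.val_pow_eq_pow_val, ZMod.coe_unitOfCoprime, Nat.cast_ofNat,
      Units.val_one] using congrArg Units.val h

theorem isDoublingPeriod_Upow (hn : Odd n) (hn3 : 3 ≤ n) (ι : ZMod n →+ G)
    (hι : Function.Injective ι) (a : (ZMod n)ˣ) : IsDoublingPeriod (Upow n) (ι a) := by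
  have hself : ∀ j : ℕ, 2 ^ j • ι a = ι a ↔ (2 : ZMod n) ^ j = 1 := by
    intro j
    rw [← map_nsmul, hι.eq_iff, nsmul_eq_mul, a.isUnit.mul_eq_right]
    push_cast
    rfl
  have hneg : ∀ j : ℕ, 2 ^ j • ι a = -ι a ↔ (2 : ZMod n) ^ j = -1 := by
    intro j
    rw [← map_nsmul, ← map_neg, hι.eq_iff, nsmul_eq_mul, ← neg_one_mul (a : ZMod n),
      a.mul_left_inj]
    push_cast
    rfl
  have hmin : ∀ j < Upow n, 1 ≤ j → ¬((2 : ZMod n) ^ j = 1 ∨ (2 : ZMod n) ^ j = -1) :=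
    fun j hj h1 h => Nat.notMem_of_lt_sInf hj ⟨h1, h⟩
  have hspec := Upow_spec hn
  refine ⟨hspec.1, ?_, fun j hj => ?_, fun j hj h1 => ?_⟩
  · rw [hself, hneg]
    exact hspec.2
  · rw [Ne, hneg]
    rcases Nat.eq_zero_or_pos j with rfl | h1
    · have : Fact (2 < n) := ⟨hn3⟩
      rw [pow_zero]
      exact ZMod.neg_one_ne_one.symm
    · exact fun h => hmin j hj h1 (Or.inr h)
  · rw [Ne, hself]
    exact fun h => hmin j hj h1 (Or.inl h)

theorem map_unit_mem_iff (ι : ZMod n →+ G) (a b : (ZMod n)ˣ) (H : AddSubgroup G) :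
    ι a ∈ H ↔ ι b ∈ H := by
  have key : ∀ a b : (ZMod n)ˣ, ι a ∈ H → ι b ∈ H := by
    intro a b h
    obtain ⟨m, hm⟩ := ZMod.intCast_surjective ((b : ZMod n) * ((a⁻¹ : (ZMod n)ˣ) : ZMod n))
    have : (b : ZMod n) = m • (a : ZMod n) := by
      rw [zsmul_eq_mul, hm, mul_assoc, Units.inv_mul, mul_one]
    rw [this, map_zsmul]
    exact H.zsmul_mem h m
  exact ⟨key a b, key b a⟩

theorem exists_injective_hom_zmod {g h : G} (hg : 0 < addOrderOf g)
    (hh : h ∈ AddSubgroup.zmultiples g) (hgh : addOrderOf h = addOrderOf g) :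
    ∃ (ι : ZMod (addOrderOf g) →+ G) (b : (ZMod (addOrderOf g))ˣ),
      Function.Injective ι ∧ ι ((1 : (ZMod (addOrderOf g))ˣ) : ZMod (addOrderOf g)) = g ∧
      ι b = h := by
  set n := addOrderOf g with hn
  let ι : ZMod n →+ G := ZMod.lift n ⟨zmultiplesHom G g, by
    simp [hn, addOrderOf_nsmul_eq_zero]⟩
  have hint : ∀ m : ℤ, ι m = m • g := by
    intro m
    simp [ι]
  have hinj : Function.Injective ι := by
    rw [ZMod.lift_injective]
    intro m hm
    rw [ZMod.intCast_zmod_eq_zero_iff_dvd, hn, addOrderOf_dvd_iff_zsmul_eq_zero]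
    simpa using hm
  obtain ⟨m, rfl⟩ := AddSubgroup.mem_zmultiples_iff.mp hh
  have : Finite (AddSubgroup.zmultiples g) :=
    Set.finite_coe_iff.mpr (finite_zmultiples.mpr (addOrderOf_pos_iff.mp hg))
  have heq : AddSubgroup.zmultiples (m • g) = AddSubgroup.zmultiples g := by
    refine AddSubgroup.eq_of_le_of_card_ge (AddSubgroup.zmultiples_le_of_mem hh) ?_
    rw [Nat.card_zmultiples, Nat.card_zmultiples, hgh]
  have hg' : g ∈ AddSubgroup.zmultiples (m • g) := heq ▸ AddSubgroup.mem_zmultiples g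
  obtain ⟨l, hl⟩ := AddSubgroup.mem_zmultiples_iff.mp hg'
  have hone : ι 1 = g := by simpa using hint 1
  have hml : (m : ZMod n) * (l : ZMod n) = 1 := by
    apply hinj
    rw [hone, ← Int.cast_mul, hint, mul_comm, mul_zsmul, hl]
  exact ⟨ι, Units.mkOfMulEqOne _ _ hml, hinj, hone, hint m⟩

end ZModOrbits

theorem exists_mul_neg_of_memV {G : Type*} [AddCommGroup G] {μ : G → ℤ} (hμ : memV μ)
    (H : AddSubgroup G) {g : G} (hg : g ∈ H) (hne : μ g + μ (-g) ≠ 0) :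
    ∃ h ∈ H, (μ h + μ (-h)) * (μ g + μ (-g)) < 0 := by
  by_contra! hcon
  set ν : G → ℤ := fun x => μ x + μ (-x) with hν
  have hfin' : (Function.support fun x => μ (-x)).Finite :=
    hμ.1.preimage (neg_injective.injOn (s := _))
  have hνfin : (Function.support ν).Finite :=
    (hμ.1.union hfin').subset (Function.support_add _ _)
  have hneg : ∑ᶠ x ∈ (H : Set G), μ (-x) = 0 := by
    rw [← hμ.2.2 H]
    exact finsum_mem_eq_of_bijOn Neg.neg
      ⟨fun x hx => H.neg_mem hx, neg_injective.injOn,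
        fun x hx => ⟨-x, H.neg_mem hx, neg_neg x⟩⟩ fun x _ => rfl
  have hsum : ∑ᶠ x ∈ (H : Set G), ν x = 0 := by
    rw [hν, finsum_mem_add_distrib' (hμ.1.inter_of_right _) (hfin'.inter_of_right _),
      hμ.2.2 H, hneg, add_zero]
  have hfinH : ((H : Set G) ∩ Function.support ν).Finite := hνfin.inter_of_right _
  rw [← finsum_mem_inter_support, finsum_mem_eq_finite_toFinset_sum _ hfinH] at hsum
  have hzero : ∑ x ∈ hfinH.toFinset, ν x * ν g = 0 := by
    rw [← Finset.sum_mul, hsum, zero_mul]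
  rw [Finset.sum_eq_zero_iff_of_nonneg] at hzero
  · have := hzero g (by simpa using ⟨hg, hne⟩)
    exact hne (mul_self_eq_zero.mp this)
  · intro x hx
    rw [Set.Finite.mem_toFinset] at hx
    exact hcon x hx.1

theorem memV_mem_submodule {G : Type*} [AddCommGroup G] (h2 : ∀ g : G, g + g = 0 → g = 0)
    (N : Submodule ℤ (G → ℤ))
    (hN : ∀ g : G, ({g} : Set G).indicator (1 : G → ℤ) - ({-g} : Set G).indicator (1 : G → ℤ) ∈ N)
    (hU : ∀ n : ℕ, Odd n → 3 ≤ n → ∀ (α β : (ZMod n)ˣ) (ι : ZMod n →+ G),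
      Function.Injective ι → (doublingSet (Upow n) (ι α)).indicator (1 : G → ℤ) -
        (doublingSet (Upow n) (ι β)).indicator (1 : G → ℤ) ∈ N)
    (μ : G → ℤ) (hμ : memV μ) : μ ∈ N := by
  classical
  induction hc : (Function.support fun x => μ x + μ (-x)).ncard using Nat.strong_induction_on
    generalizing μ with
  | _ c ih =>
  set ν : G → ℤ := fun x => μ x + μ (-x) with hν
  have hνfin : (Function.support ν).Finite :=
    (hμ.1.union (hμ.1.preimage (neg_injective.injOn (s := _)))).subset (Function.support_add _ _)
  by_cases hν0 : ∀ x, ν x = 0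
  · exact odd_function_mem_submodule N hN μ hμ.1 hν0
  push Not at hν0
  have hνneg : ∀ x, ν (-x) = ν x := by
    intro x
    simp only [hν, neg_neg]
    exact add_comm _ _
  have hνpow : ∀ (i : ℕ) (x : G), ν (2 ^ i • x) = ν x := by
    intro i x
    induction i with
    | zero => simp
    | succ i ih =>
      rw [two_pow_succ_nsmul, ← ih]
      exact (hμ.2.1 _).symm
  have hνorbit : ∀ (k : ℕ) (x y : G), x ∈ doublingSet k y ∨ -x ∈ doublingSet k y →
      ν x = ν y := by
    rintro k x y (⟨i, -, h⟩ | ⟨i, -, h⟩)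
    · rw [h, hνpow]
    · rw [← hνneg, h, hνpow]
  have hord : ∀ x, ν x ≠ 0 → 0 < addOrderOf x := fun x hx =>
    addOrderOf_pos_of_doubling_finite hνfin (g := x) fun i => by
      rw [Function.mem_support, hνpow]
      exact hx
  obtain ⟨g, hg, hgmin⟩ : ∃ g, ν g ≠ 0 ∧ ∀ x, ν x ≠ 0 → addOrderOf g ≤ addOrderOf x := by
    obtain ⟨g, hg, hgmin⟩ := exists_minimalFor_of_wellFoundedLT (fun x => ν x ≠ 0) addOrderOf hν0
    exact ⟨g, hg, fun x hx => (le_total _ _).elim id fun h => hgmin hx h⟩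
  obtain ⟨h, hh, hlt⟩ := exists_mul_neg_of_memV hμ (AddSubgroup.zmultiples g)
    (AddSubgroup.mem_zmultiples g) hg
  change ν h * ν g < 0 at hlt
  have hh0 : ν h ≠ 0 := fun h0 => by simp [h0] at hlt
  have hhg : ν h ≠ ν g := fun heq => by
    rw [heq] at hlt
    exact absurd hlt (not_lt.mpr (mul_self_nonneg _))
  have hgpos := hord g hg
  have hgh : addOrderOf h = addOrderOf g := by
    obtain ⟨m, rfl⟩ := AddSubgroup.mem_zmultiples_iff.mp hh
    refine le_antisymm (Nat.le_of_dvd hgpos ?_) (hgmin _ hh0)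
    exact addOrderOf_dvd_of_mem_zmultiples hh
  obtain ⟨ι, b, hι, h1, hb⟩ := exists_injective_hom_zmod hgpos hh hgh
  have hodd := odd_addOrderOf h2 hgpos
  have hne1 : addOrderOf g ≠ 1 := by
    rw [Ne, AddMonoid.addOrderOf_eq_one_iff]
    rintro rfl
    have hbot := hμ.2.2 ⊥
    simp only [AddSubgroup.coe_bot, finsum_mem_singleton] at hbot
    apply hg
    simp [hν, hbot]
  have hn3 : 3 ≤ addOrderOf g := by
    obtain ⟨m, hm⟩ := hodd
    omega
  have hdg := isDoublingPeriod_Upow hodd hn3 ι hι 1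
  have hdh := isDoublingPeriod_Upow hodd hn3 ι hι b
  have hfN := hU _ hodd hn3 1 b ι hι
  have hfV := memV_indicator_sub_indicator h2 hdg hdh (map_unit_mem_iff ι 1 b)
  rw [h1] at hdg
  rw [hb] at hdh
  rw [h1, hb] at hfN hfV
  set k := Upow (addOrderOf g)
  set f : G → ℤ := (doublingSet k g).indicator (1 : G → ℤ) -
    (doublingSet k h).indicator (1 : G → ℤ) with hf
  have hfsum : ∀ x, f x + f (-x) =
      (if x ∈ doublingSet k g ∨ -x ∈ doublingSet k g then 1 else 0) -
      (if x ∈ doublingSet k h ∨ -x ∈ doublingSet k h then 1 else 0) := by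
    intro x
    rw [← hdg.indicator_add_indicator_neg h2, ← hdh.indicator_add_indicator_neg h2, hf]
    simp only [Pi.sub_apply]
    ring
  have hνnew : ∀ x, (μ + (-ν g) • f) x + (μ + (-ν g) • f) (-x) =
      ν x - ν g * (f x + f (-x)) := by
    intro x
    simp only [hν, Pi.add_apply, Pi.smul_apply, smul_eq_mul]
    ring
  have hsub : (Function.support fun x => (μ + (-ν g) • f) x + (μ + (-ν g) • f) (-x)) ⊆
      Function.support ν \ {g} := by
    intro x hx
    rw [Function.mem_support, hνnew, hfsum] at hx
    refine ⟨fun hx0 => hx ?_, ?_⟩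
    · have hxg : ¬(x ∈ doublingSet k g ∨ -x ∈ doublingSet k g) := fun hxg =>
        hg ((hνorbit k x g hxg).symm.trans hx0)
      have hxh : ¬(x ∈ doublingSet k h ∨ -x ∈ doublingSet k h) := fun hxh =>
        hh0 ((hνorbit k x h hxh).symm.trans hx0)
      rw [if_neg hxg, if_neg hxh, hx0]
      ring
    · rintro rfl
      have hxg : x ∈ doublingSet k x ∨ -x ∈ doublingSet k x :=
        Or.inl ⟨0, hdg.pos, by simp⟩
      have hxh : ¬(x ∈ doublingSet k h ∨ -x ∈ doublingSet k h) := fun hxh =>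
        hhg (hνorbit k x h hxh).symm
      rw [if_pos hxg, if_neg hxh] at hx
      exact hx (by ring)
  have hcard : (Function.support fun x => (μ + (-ν g) • f) x + (μ + (-ν g) • f) (-x)).ncard
      < c := by
    rw [← hc]
    refine Set.ncard_lt_ncard ⟨hsub.trans Set.sdiff_subset, fun hle => ?_⟩ hνfin
    exact (hsub (hle (show g ∈ Function.support ν from hg))).2 rfl
  have hrec := ih _ hcard _ (hμ.add (hfV.smul (-ν g))) rfl
  have := N.add_mem hrec (N.smul_mem (ν g) hfN)
  rwa [neg_smul, neg_add_cancel_right] at this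

theorem stmt9 {G : Type*} [AddCommGroup G] (h2 : ∀ g : G, g + g = 0 → g = 0) :
    {μ : G → ℤ | memV μ} =
      ↑(Submodule.span ℤ
        ({f : G → ℤ | ∃ g : G,
            f = ({g} : Set G).indicator (1 : G → ℤ) - ({-g} : Set G).indicator (1 : G → ℤ)} ∪
         {f : G → ℤ | ∃ n : ℕ, Odd n ∧ 3 ≤ n ∧ ∃ (α β : (ZMod n)ˣ) (ι : ZMod n →+ G),
            Function.Injective ⇑ι ∧
            f = (⇑ι '' ((fun u => (α : ZMod n) * u) '' (Uset n : Set (ZMod n)))).indicator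
                  (1 : G → ℤ) -
                (⇑ι '' ((fun u => (β : ZMod n) * u) '' (Uset n : Set (ZMod n)))).indicator
                  (1 : G → ℤ)})) := by
  refine Set.Subset.antisymm (fun μ hμ => ?_) (fun μ hμ => ?_)
  · refine memV_mem_submodule h2 _ (fun g => ?_) (fun n hn hn3 α β ι hι => ?_) μ hμ
    · exact Submodule.subset_span (Or.inl ⟨g, rfl⟩)
    · refine Submodule.subset_span (Or.inr ⟨n, hn, hn3, α, β, ι, hι, ?_⟩)
      rw [image_mul_Uset, image_mul_Uset]
  · refine Submodule.span_induction (p := fun f _ => memV f) ?_ memV_zero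
      (fun _ _ _ _ h h' => h.add h') (fun c _ _ h => h.smul c) hμ
    rintro f (⟨g, rfl⟩ | ⟨n, hn, hn3, α, β, ι, hι, rfl⟩)
    · exact memV_indicator_singleton_sub g
    · rw [image_mul_Uset, image_mul_Uset]
      exact memV_indicator_sub_indicator h2 (isDoublingPeriod_Upow hn hn3 ι hι α)
        (isDoublingPeriod_Upow hn hn3 ι hι β) (map_unit_mem_iff ι α β)
end

section
/- Let n be an odd natural number, and let A, B be finite multisets of ℤ/nℤ such that FS(A) = FS(B) + s for some s ∈ ℤ/nℤ. Then μ_A − μ_B ∈ V(ℤ/nℤ). -/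
open scoped BigOperators

/-- The multiset of all `2^|A|` subset sums of a finite multiset `A`. -/
def FS {G : Type*} [AddCommMonoid G] (A : Multiset G) : Multiset G :=
  A.powerset.map Multiset.sum

open Filter Topology

theorem sum_range_natCast_zmod {M : Type*} [AddCommMonoid M] {N : ℕ} [NeZero N] (g : ZMod N → M) :
    ∑ i ∈ Finset.range N, g i = ∑ x, g x :=
  Finset.sum_nbij' (fun i => (i : ZMod N)) ZMod.val (by simp) (by simp [ZMod.val_lt])
    (fun i hi => ZMod.val_cast_of_lt (Finset.mem_range.1 hi)) (by simp) (by simp)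

theorem exists_norm_sum_range_le_of_sum_eq_zero {N : ℕ} [NeZero N] {f : ZMod N → ℂ}
    (hf : ∑ x, f x = 0) :
    ∃ C : ℝ, ∀ M : ℕ, ‖∑ i ∈ Finset.range M, f (i + 1 : ℕ)‖ ≤ C := by
  have hper : Function.Periodic (fun M : ℕ => ∑ i ∈ Finset.range M, f (i + 1 : ℕ)) N := by
    intro M
    simp only [Finset.sum_range_add, add_eq_left]
    have := sum_range_natCast_zmod (fun x : ZMod N => f (x + (M + 1)))
    rw [show ∑ x, f (x + (M + 1)) = ∑ x, f x from Equiv.sum_comp (Equiv.addRight _) f, hf] at this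
    rw [← this]
    refine Finset.sum_congr rfl fun i _ => ?_
    push_cast
    ring_nf
  refine ⟨∑ M ∈ Finset.range N, ‖∑ i ∈ Finset.range M, f (i + 1 : ℕ)‖, fun M => ?_⟩
  rw [← hper.map_mod_nat M]
  exact Finset.single_le_sum (f := fun M => ‖∑ i ∈ Finset.range M, f (i + 1 : ℕ)‖)
    (fun _ _ => norm_nonneg _) (Finset.mem_range.2 (Nat.mod_lt _ (NeZero.pos N)))

theorem rpow_neg_sub_rpow_neg_succ_le {s : ℝ} (h₁ : 1 ≤ s) (h₂ : s ≤ 2) (m : ℕ) :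
    |((m : ℝ) + 1) ^ (-s) - ((m : ℝ) + 2) ^ (-s)| ≤ 2 * (1 / ((m : ℝ) + 1) ^ 2) := by
  have hx : (0 : ℝ) < m + 1 := by positivity
  have hy : (0 : ℝ) < m + 2 := by positivity
  have hm : (0 : ℝ) ≤ m := by positivity
  have h0 : ((m : ℝ) + 2) ^ (-s) ≤ ((m : ℝ) + 1) ^ (-s) :=
    Real.rpow_le_rpow_of_nonpos hx (by linarith) (by linarith)
  rw [abs_of_nonneg (by linarith)]
  set q : ℝ := (m + 1) / (m + 2) with hq
  have hq0 : 0 < q := by positivity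
  have hq1 : q ≤ 1 := by rw [hq, div_le_one hy]; linarith
  have e : ((m : ℝ) + 2) ^ (-s) = ((m : ℝ) + 1) ^ (-s) * q ^ s := by
    rw [hq, Real.div_rpow hx.le hy.le, Real.rpow_neg hx.le, Real.rpow_neg hy.le]
    have := (Real.rpow_pos_of_pos hx s).ne'
    field_simp
  have hqs : q ^ 2 ≤ q ^ s := by
    rw [← Real.rpow_natCast]
    exact Real.rpow_le_rpow_of_exponent_ge hq0 hq1 (by exact_mod_cast h₂)
  have hqs1 : q ^ s ≤ 1 := Real.rpow_le_one hq0.le hq1 (by linarith)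
  have hxs : ((m : ℝ) + 1) ^ (-s) ≤ ((m : ℝ) + 1)⁻¹ := by
    rw [← Real.rpow_neg_one]
    exact Real.rpow_le_rpow_of_exponent_le (by linarith) (by linarith)
  rw [e]
  calc _ = ((m : ℝ) + 1) ^ (-s) * (1 - q ^ s) := by ring
    _ ≤ ((m : ℝ) + 1)⁻¹ * (1 - q ^ 2) := by
        apply mul_le_mul hxs (by linarith) (by linarith) (by positivity)
    _ ≤ _ := by
        rw [hq]
        have : (1 : ℝ) - ((m + 1) / (m + 2)) ^ 2 ≤ 2 * (1 / (m + 1)) := by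
          rw [div_pow, one_sub_div (by positivity), mul_one_div, div_le_div_iff₀ (by positivity) hx]
          nlinarith
        calc _ ≤ ((m : ℝ) + 1)⁻¹ * (2 * (1 / (m + 1))) := by gcongr
          _ = _ := by field_simp

theorem sum_range_mul_eq_sum_by_parts (a g : ℕ → ℂ) (M : ℕ) :
    ∑ m ∈ Finset.range M, a m * g m =
      ∑ m ∈ Finset.range M, (∑ i ∈ Finset.range (m + 1), a i) * (g m - g (m + 1)) +
        (∑ i ∈ Finset.range M, a i) * g M := by
  induction M with
  | zero => simp
  | succ M ih =>
    rw [Finset.sum_range_succ, ih, Finset.sum_range_succ (fun m => _ * (g m - g (m + 1))),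
      Finset.sum_range_succ a M]
    ring

/-- For a periodic function of mean zero, the Dirichlet series still converges at `1`, to the value
of the analytically continued `L`-function. -/
theorem tendsto_sum_div_LFunction_one {N : ℕ} [NeZero N] {f : ZMod N → ℂ} (hf : ∑ x, f x = 0) :
    Tendsto (fun M => ∑ m ∈ Finset.range M, f (m : ℕ) / (m : ℂ)) atTop
      (𝓝 (ZMod.LFunction f 1)) := by
  obtain ⟨C, hC⟩ := exists_norm_sum_range_le_of_sum_eq_zero hf
  have hC0 : 0 ≤ C := (norm_nonneg _).trans (hC 0)
  set S : ℕ → ℂ := fun M => ∑ i ∈ Finset.range M, f (i + 1 : ℕ) with hS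
  let g : ℝ → ℕ → ℂ := fun s m => (((m : ℝ) + 1) ^ (-s) : ℝ)
  let t : ℝ → ℕ → ℂ := fun s m => S (m + 1) * (g s m - g s (m + 1))
  have hbs : Summable fun m : ℕ => C * (2 * (1 / ((m : ℝ) + 1) ^ 2)) := by
    have := (summable_nat_add_iff 1).2 (Real.summable_one_div_nat_pow.2 one_lt_two)
    push_cast at this
    exact (this.mul_left 2).mul_left C
  have hb : ∀ s : ℝ, 1 ≤ s → s ≤ 2 → ∀ m, ‖t s m‖ ≤ C * (2 * (1 / ((m : ℝ) + 1) ^ 2)) := by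
    intro s h₁ h₂ m
    rw [norm_mul]
    refine mul_le_mul (hC _) ?_ (norm_nonneg _) hC0
    have := rpow_neg_sub_rpow_neg_succ_le h₁ h₂ m
    simp only [g]
    rw [← Complex.ofReal_sub, Complex.norm_real, Real.norm_eq_abs]
    push_cast
    rwa [add_assoc, one_add_one_eq_two]
  have hpart : ∀ s : ℝ, 1 ≤ s → s ≤ 2 →
      Tendsto (fun M => ∑ m ∈ Finset.range M, f (m + 1 : ℕ) * g s m) atTop (𝓝 (∑' m, t s m)) := by
    intro s h₁ h₂
    have hsum : Summable (t s) := .of_norm_bounded hbs (hb s h₁ h₂)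
    have hg : Tendsto (fun M => S M * g s M) atTop (𝓝 0) := by
      rw [tendsto_zero_iff_norm_tendsto_zero]
      have h0 : Tendsto (fun M : ℕ => C * (((M : ℝ) + 1) ^ (-s))) atTop (𝓝 (C * 0)) :=
        ((tendsto_rpow_neg_atTop (by linarith)).comp
          (tendsto_atTop_add_const_right _ _ tendsto_natCast_atTop_atTop)).const_mul C
      rw [mul_zero] at h0
      refine squeeze_zero (fun _ => norm_nonneg _) (fun M => ?_) h0
      rw [norm_mul, Complex.norm_real, Real.norm_of_nonneg (by positivity)]
      gcongr
      exact hC M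
    have := hsum.hasSum.tendsto_sum_nat.add hg
    rw [add_zero] at this
    exact this.congr fun M => (sum_range_mul_eq_sum_by_parts _ _ _).symm
  have hL : ∀ s : ℝ, 1 < s → s ≤ 2 → ZMod.LFunction f s = ∑' m, t s m := by
    intro s h₁ h₂
    have hre : 1 < (s : ℂ).re := by simpa
    rw [ZMod.LFunction_eq_LSeries f hre]
    have := (ZMod.LSeriesSummable_of_one_lt_re f hre).hasSum
    have := ((hasSum_nat_add_iff' 1).2 this).tendsto_sum_nat
    simp only [Finset.range_one, Finset.sum_singleton, LSeries.term_zero, sub_zero] at this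
    refine tendsto_nhds_unique (this.congr fun M => ?_) (hpart s h₁.le h₂)
    refine Finset.sum_congr rfl fun m _ => ?_
    rw [LSeries.term_of_ne_zero (by simp), div_eq_mul_inv, ← Complex.cpow_neg]
    simp only [g]
    rw [Complex.ofReal_cpow (by positivity)]
    push_cast
    rfl
  have hlim : Tendsto (fun s : ℝ => ∑' m, t s m) (𝓝[>] 1) (𝓝 (∑' m, t 1 m)) := by
    refine tendsto_tsum_of_dominated_convergence hbs (fun m => ?_) ?_
    · have hg : ∀ m, Continuous fun s => g s m := fun m =>
        Complex.continuous_ofReal.comp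
          (continuous_const.rpow continuous_neg fun _ => Or.inl (by positivity))
      exact ((((hg m).sub (hg (m + 1))).const_smul (S (m + 1))).tendsto 1).mono_left
        nhdsWithin_le_nhds
    · filter_upwards [Ioc_mem_nhdsGT (one_lt_two (α := ℝ))] with s hs
      exact hb s hs.1.le hs.2
  have hlim' : Tendsto (fun s : ℝ => ZMod.LFunction f s) (𝓝[>] 1) (𝓝 (ZMod.LFunction f 1)) := by
    have := ((ZMod.differentiable_LFunction_of_sum_zero hf).continuous.comp
      Complex.continuous_ofReal).tendsto 1
    simpa [Function.comp_def] using this.mono_left nhdsWithin_le_nhds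
  have heq : ZMod.LFunction f 1 = ∑' m, t 1 m := by
    refine tendsto_nhds_unique hlim' (hlim.congr' ?_)
    filter_upwards [Ioc_mem_nhdsGT (one_lt_two (α := ℝ))] with s hs
    exact (hL s hs.1 hs.2).symm
  rw [heq, ← tendsto_add_atTop_iff_nat 1]
  refine (hpart 1 le_rfl one_le_two).congr fun M => ?_
  rw [Finset.sum_range_succ' _ M]
  simp only [g, Nat.cast_zero, div_zero, add_zero]
  refine Finset.sum_congr rfl fun m _ => ?_
  rw [Real.rpow_neg_one, div_eq_mul_inv]
  push_cast
  rfl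

theorem ZMod.LFunction_sum_mul {ι : Type*} [Fintype ι] {N : ℕ} [NeZero N] (c : ι → ℂ)
    (F : ι → ZMod N → ℂ) (s : ℂ) :
    ZMod.LFunction (fun x => ∑ i, c i * F i x) s = ∑ i, c i * ZMod.LFunction (F i) s := by
  simp only [ZMod.LFunction, Finset.mul_sum, Finset.sum_mul]
  rw [Finset.sum_comm]
  refine Finset.sum_congr rfl fun i _ => Finset.sum_congr rfl fun x _ => ?_
  ring

theorem eq_zero_of_LFunction_unit_mul_one_eq_zero {N : ℕ} [NeZero N] {f : ZMod N → ℂ}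
    (h0 : ∀ x, ¬IsUnit x → f x = 0) (hsum : ∑ x, f x = 0)
    (hL : ∀ k : (ZMod N)ˣ, ZMod.LFunction (fun x => f ((k : ZMod N) * x)) 1 = 0) : f = 0 := by
  have hC : ∀ χ : DirichletCharacter ℂ N, ∑ k : (ZMod N)ˣ, χ ↑k⁻¹ * f k = 0 := by
    intro χ
    rcases eq_or_ne χ 1 with rfl | hχ
    · rw [← hsum, ← Finset.sum_subset (Finset.subset_univ (Finset.univ.map
        ⟨((↑) : (ZMod N)ˣ → ZMod N), Units.val_injective⟩))]
      · rw [Finset.sum_map]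
        exact Finset.sum_congr rfl fun k _ => by
          rw [MulChar.one_apply_coe, one_mul]
          rfl
      · intro x _ hx
        refine h0 x fun ⟨u, hu⟩ => hx ?_
        simpa using ⟨u, hu⟩
    · have key : (fun x => ∑ k : (ZMod N)ˣ, χ ↑k⁻¹ * f (k * x)) =
          fun x => ∑ _i : Unit, (∑ k : (ZMod N)ˣ, χ ↑k⁻¹ * f k) * χ x := by
        funext x
        rw [Fintype.sum_unique (ι := Unit)]
        by_cases hx : IsUnit x
        · obtain ⟨u, rfl⟩ := hx
          rw [Finset.sum_mul, ← Equiv.sum_comp (Equiv.mulRight u)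
            (fun k : (ZMod N)ˣ => χ ↑k⁻¹ * f k * χ u)]
          refine Finset.sum_congr rfl fun k _ => ?_
          rw [mul_right_comm, ← map_mul, Equiv.coe_mulRight, mul_inv_rev, mul_comm u⁻¹,
            Units.val_mul, mul_assoc, Units.inv_mul, mul_one, Units.val_mul]
        · rw [MulChar.map_nonunit χ hx, mul_zero]
          refine Finset.sum_eq_zero fun k _ => ?_
          rw [h0 _ (by simpa using hx), mul_zero]
      have := congrArg (fun g => ZMod.LFunction g 1) key
      simp only [ZMod.LFunction_sum_mul, hL, mul_zero, Finset.sum_const_zero] at this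
      rw [Fintype.sum_unique] at this
      exact (mul_eq_zero.1 this.symm).resolve_right
        (DirichletCharacter.LFunction_apply_one_ne_zero hχ)
  funext b
  by_cases hb : IsUnit b
  · have h1 : ∑ χ : DirichletCharacter ℂ N, χ b * ∑ k : (ZMod N)ˣ, χ ↑k⁻¹ * f k = 0 :=
      Finset.sum_eq_zero fun χ _ => by rw [hC, mul_zero]
    simp only [Finset.mul_sum] at h1
    rw [Finset.sum_comm] at h1
    obtain ⟨u, rfl⟩ := hb
    have h2 : ∀ k : (ZMod N)ˣ, ∑ χ : DirichletCharacter ℂ N, χ u * (χ ↑k⁻¹ * f k) =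
        if k = u then (N.totient : ℂ) * f k else 0 := by
      intro k
      have := DirichletCharacter.sum_char_inv_mul_char_eq ℂ k.isUnit (u : ZMod N)
      rw [← ZMod.inv_coe_unit]
      simp only [Units.val_inj] at this
      rw [← ite_zero_mul, ← this, Finset.sum_mul]
      exact Finset.sum_congr rfl fun χ _ => by ring
    simp only [h2, Finset.sum_ite_eq', Finset.mem_univ, if_true] at h1
    refine (mul_eq_zero.1 h1).resolve_left ?_
    exact_mod_cast (Nat.totient_pos.2 (NeZero.pos N)).ne'
  · exact h0 b hb

theorem eq_zero_of_tendsto_sum_mul_div {n : ℕ} [NeZero n] {F : ZMod n → ℂ}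
    (hsum : ∀ d N : ℕ, d * N = n → ∑ m ∈ Finset.range N, F ((d * m : ℕ)) = 0)
    (hF : ∀ k : ℕ, Tendsto (fun M => ∑ m ∈ Finset.range M, F ((k * m : ℕ)) / (m : ℂ)) atTop (𝓝 0)) :
    F = 0 := by
  have key : ∀ N d : ℕ, d * N = n → ∀ m : ℕ, F ((d * m : ℕ)) = 0 := by
    intro N
    induction N using Nat.strong_induction_on with
    | _ N ih =>
    intro d hd
    have hN0 : N ≠ 0 := by
      rintro rfl
      exact NeZero.ne n (by simpa using hd.symm)
    have : NeZero N := ⟨hN0⟩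
    set f : ZMod N → ℂ := fun x => F ((d * x.val : ℕ)) with hf
    have hcast : ∀ m : ℕ, f m = F ((d * m : ℕ)) := by
      intro m
      simp only [hf, ZMod.val_natCast]
      congr 1
      rw [ZMod.natCast_eq_natCast_iff, ← hd]
      exact (Nat.mod_modEq m N).mul_left' d
    have hs : ∑ x, f x = 0 := by
      rw [← sum_range_natCast_zmod, ← hsum d N hd]
      exact Finset.sum_congr rfl fun m _ => hcast m
    have : f = 0 := by
      refine eq_zero_of_LFunction_unit_mul_one_eq_zero (fun x hx => ?_) hs fun k => ?_
      · rw [← ZMod.natCast_zmod_val x, ZMod.isUnit_iff_coprime] at hx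
        obtain ⟨a, ha⟩ := Nat.gcd_dvd_left x.val N
        obtain ⟨b, hb⟩ := Nat.gcd_dvd_right x.val N
        have hg0 : 0 < Nat.gcd x.val N := Nat.gcd_pos_of_pos_right _ (NeZero.pos N)
        have hg : 1 < Nat.gcd x.val N := lt_of_le_of_ne hg0 (Ne.symm hx)
        have hb0 : 0 < b := Nat.pos_of_ne_zero fun h => hN0 (by rw [hb, h, mul_zero])
        have := ih b (by nlinarith) (d * Nat.gcd x.val N) (by rw [mul_assoc, ← hb, hd]) a
        rwa [mul_assoc, ← ha] at this
      · have hs' : ∑ x, f (k * x) = 0 := by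
          rw [show ∑ x, f (k * x) = ∑ x, f x from Equiv.sum_comp (Units.mulLeft k) f, hs]
        refine tendsto_nhds_unique (tendsto_sum_div_LFunction_one hs')
          ((hF (d * (k : ZMod N).val)).congr fun M => Finset.sum_congr rfl fun m _ => ?_)
        rw [mul_assoc, ← hcast]
        simp
    intro m
    rw [← hcast, this]
    rfl
  funext x
  simpa using key n 1 (one_mul n) x.val

theorem norm_stdAddChar {n : ℕ} [NeZero n] (x : ZMod n) : ‖ZMod.stdAddChar x‖ = 1 := by
  rw [ZMod.stdAddChar_apply, Circle.norm_coe]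

theorem stdAddChar_eq_one_iff {n : ℕ} [NeZero n] {x : ZMod n} :
    ZMod.stdAddChar x = (1 : ℂ) ↔ x = 0 := by
  rw [← AddChar.map_zero_eq_one (ZMod.stdAddChar (N := n)), ZMod.injective_stdAddChar.eq_iff]

theorem two_mul_eq_zero_iff_of_odd {n : ℕ} (hn : Odd n) {x : ZMod n} : 2 * x = 0 ↔ x = 0 := by
  have h2 : IsUnit ((2 : ℕ) : ZMod n) :=
    (ZMod.isUnit_iff_coprime 2 n).2 (Nat.coprime_two_left.2 hn)
  exact_mod_cast h2.mul_right_eq_zero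

/-- The Taylor series of `-log(1 - z)` converges to it at any nontrivial root of unity `z`. -/
theorem tendsto_sum_stdAddChar_div {n : ℕ} [NeZero n] {x : ZMod n} (hx : x ≠ 0) :
    Tendsto (fun M => ∑ m ∈ Finset.range M, ZMod.stdAddChar (x * ((m : ℕ) : ZMod n)) / (m : ℂ)) atTop
      (𝓝 (-Complex.log (1 - ZMod.stdAddChar x))) := by
  have hsum : ∑ y, ZMod.stdAddChar (x * y) = (0 : ℂ) := by
    simp only [mul_comm x, AddChar.sum_mulShift _ (ZMod.isPrimitive_stdAddChar n), hx, if_false,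
      Nat.cast_zero]
  have hT := tendsto_sum_div_LFunction_one hsum
  have hA := Complex.tendsto_tsum_powerSeries_nhdsWithin_lt hT
  rw [Filter.tendsto_map'_iff] at hA
  have hne : (1 : ℂ) - ZMod.stdAddChar x ≠ 0 :=
    sub_ne_zero.2 fun h => hx (stdAddChar_eq_one_iff.1 h.symm)
  have hslit : (1 : ℂ) - ZMod.stdAddChar x ∈ Complex.slitPlane := by
    refine Or.inl ?_
    have h1 := norm_stdAddChar x
    have h2 : (ZMod.stdAddChar x : ℂ).re ≤ 1 := h1 ▸ Complex.re_le_norm _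
    rcases h2.lt_or_eq with h | h
    · simpa using h
    · refine absurd ?_ hne
      have him : (ZMod.stdAddChar x : ℂ).im = 0 := by
        have := Complex.sq_norm (ZMod.stdAddChar x : ℂ)
        rw [h1, Complex.normSq_apply, h] at this
        nlinarith
      exact Complex.ext (by simp [h]) (by simp [him])
  have hlog : Tendsto (fun r : ℝ => -Complex.log (1 - ZMod.stdAddChar x * r)) (𝓝[<] 1)
      (𝓝 (-Complex.log (1 - ZMod.stdAddChar x))) := by
    have hc : Tendsto (fun r : ℝ => (1 : ℂ) - ZMod.stdAddChar x * r) (𝓝[<] 1)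
        (𝓝 (1 - ZMod.stdAddChar x)) := by
      have : Continuous fun r : ℝ => (1 : ℂ) - ZMod.stdAddChar x * r := by fun_prop
      simpa using (this.tendsto 1).mono_left nhdsWithin_le_nhds
    exact (hc.clog hslit).neg
  rwa [tendsto_nhds_unique hA (hlog.congr' ?_)] at hT
  filter_upwards [Ioo_mem_nhdsLT (zero_lt_one (α := ℝ))] with r hr
  have hnorm : ‖(ZMod.stdAddChar x : ℂ) * r‖ < 1 := by
    rw [norm_mul, norm_stdAddChar, one_mul, Complex.norm_real, Real.norm_of_nonneg hr.1.le]
    exact hr.2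
  rw [← (Complex.hasSum_taylorSeries_neg_log hnorm).tsum_eq]
  refine tsum_congr fun m => ?_
  rw [mul_pow, ← AddChar.map_nsmul_eq_pow, nsmul_eq_mul, mul_comm (m : ZMod n)]
  ring

theorem tendsto_sum_re_stdAddChar_sub_div {n : ℕ} [NeZero n] (hn : Odd n) (x : ZMod n) :
    Tendsto (fun M => ∑ m ∈ Finset.range M, ((ZMod.stdAddChar (2 * x * ((m : ℕ) : ZMod n)) : ℂ).re -
        (ZMod.stdAddChar (x * ((m : ℕ) : ZMod n)) : ℂ).re) / (m : ℝ)) atTop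
      (𝓝 (Real.log ‖(1 : ℂ) - ZMod.stdAddChar x‖ -
        Real.log ‖(1 : ℂ) - ZMod.stdAddChar (2 * x)‖)) := by
  by_cases hx : x = 0
  · simp [hx]
  have key : ∀ y : ZMod n, y ≠ 0 → Tendsto (fun M => ∑ m ∈ Finset.range M,
      (ZMod.stdAddChar (y * ((m : ℕ) : ZMod n)) : ℂ).re / (m : ℝ)) atTop
      (𝓝 (-Real.log ‖(1 : ℂ) - ZMod.stdAddChar y‖)) := by
    intro y hy
    have := (Complex.continuous_re.tendsto _).comp (tendsto_sum_stdAddChar_div hy)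
    rw [Complex.neg_re, Complex.log_re] at this
    refine this.congr fun M => ?_
    simp [Complex.re_sum, Complex.div_natCast_re]
  have := (key (2 * x) (mt (two_mul_eq_zero_iff_of_odd hn).1 hx)).sub (key x hx)
  simp only [← Finset.sum_sub_distrib, ← sub_div] at this
  rwa [neg_sub_neg] at this

theorem tendsto_sum_sum_re_stdAddChar_sub_div {n : ℕ} [NeZero n] (hn : Odd n) {μ : ZMod n → ℝ}
    {k : ZMod n} (h : ∑ j, μ j * (Real.log ‖(1 : ℂ) - ZMod.stdAddChar (2 * (k * j))‖ -
      Real.log ‖(1 : ℂ) - ZMod.stdAddChar (k * j)‖) = 0) :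
    Tendsto (fun M => ∑ m ∈ Finset.range M,
      (∑ j, μ j * ((ZMod.stdAddChar (2 * (k * j) * ((m : ℕ) : ZMod n)) : ℂ).re -
        (ZMod.stdAddChar (k * j * ((m : ℕ) : ZMod n)) : ℂ).re)) / (m : ℝ)) atTop (𝓝 0) := by
  have hlim := tendsto_finsetSum Finset.univ fun j _ =>
    (tendsto_sum_re_stdAddChar_sub_div hn (k * j)).const_mul (μ j)
  have hz : ∑ j, μ j * (Real.log ‖(1 : ℂ) - ZMod.stdAddChar (k * j)‖ -
      Real.log ‖(1 : ℂ) - ZMod.stdAddChar (2 * (k * j))‖) = 0 := by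
    rw [← neg_eq_zero, ← Finset.sum_neg_distrib, ← h]
    exact Finset.sum_congr rfl fun j _ => by ring
  rw [hz] at hlim
  refine hlim.congr fun M => ?_
  simp only [Finset.mul_sum, Finset.sum_div]
  rw [Finset.sum_comm]
  simp only [mul_div_assoc]

theorem sum_range_pow_sq_eq_of_odd {z : ℂ} {N : ℕ} (hN : Odd N) (hz : z ^ N = 1) :
    ∑ m ∈ Finset.range N, (z ^ 2) ^ m = ∑ m ∈ Finset.range N, z ^ m := by
  by_cases h1 : z = 1
  · simp [h1]
  have h2 : z ^ 2 ≠ 1 := by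
    intro h
    obtain ⟨t, rfl⟩ := hN
    rw [pow_succ, pow_mul, h, one_pow, one_mul] at hz
    exact h1 hz
  rw [geom_sum_eq h1, geom_sum_eq h2, hz, ← pow_mul, mul_comm, pow_mul, hz]
  simp

/-- The multiplicative relations among the `‖1 + ζ‖`, for `ζ` running over the roots of unity of a
fixed odd order, come from the distribution relations under doubling. -/
theorem even_part_comp_two_mul_eq {n : ℕ} [NeZero n] (hn : Odd n) (μ : ZMod n → ℝ)
    (h : ∀ k : ZMod n, ∑ j, μ j * (Real.log ‖(1 : ℂ) - ZMod.stdAddChar (2 * (k * j))‖ -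
      Real.log ‖(1 : ℂ) - ZMod.stdAddChar (k * j)‖) = 0) (g : ZMod n) :
    μ (2 * g) + μ (-(2 * g)) = μ g + μ (-g) := by
  let F : ZMod n → ℝ := fun k => ∑ j, μ j * ((ZMod.stdAddChar (2 * (k * j)) : ℂ).re -
      (ZMod.stdAddChar (k * j) : ℂ).re)
  have hF0 : (fun k => (F k : ℂ)) = 0 := by
    refine eq_zero_of_tendsto_sum_mul_div (fun d N hd => ?_) fun k => ?_
    · rw [← Complex.ofReal_sum, Complex.ofReal_eq_zero]
      simp only [F]
      rw [Finset.sum_comm]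
      refine Finset.sum_eq_zero fun j _ => ?_
      rw [← Finset.mul_sum, Finset.sum_sub_distrib, ← Complex.re_sum, ← Complex.re_sum]
      have hN : Odd N := (Nat.odd_mul.1 (hd ▸ hn)).2
      have hz : (ZMod.stdAddChar ((d : ZMod n) * j) : ℂ) ^ N = 1 := by
        rw [← AddChar.map_nsmul_eq_pow, nsmul_eq_mul, ← mul_assoc, mul_comm (N : ZMod n),
          ← Nat.cast_mul, hd, ZMod.natCast_self, zero_mul, AddChar.map_zero_eq_one]
      have e1 : ∀ m : ℕ, (ZMod.stdAddChar (((d * m : ℕ) : ZMod n) * j) : ℂ) =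
          (ZMod.stdAddChar ((d : ZMod n) * j) : ℂ) ^ m := by
        intro m
        rw [← AddChar.map_nsmul_eq_pow, nsmul_eq_mul]
        push_cast
        ring_nf
      have e2 : ∀ m : ℕ, (ZMod.stdAddChar (2 * (((d * m : ℕ) : ZMod n) * j)) : ℂ) =
          ((ZMod.stdAddChar ((d : ZMod n) * j) : ℂ) ^ 2) ^ m := by
        intro m
        rw [two_mul, AddChar.map_add_eq_mul, e1]
        ring
      simp only [e1, e2, sum_range_pow_sq_eq_of_odd hN hz, sub_self, mul_zero]
    · have := (Complex.continuous_ofReal.tendsto _).comp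
        (tendsto_sum_sum_re_stdAddChar_sub_div hn (h k))
      rw [Complex.ofReal_zero] at this
      refine this.congr fun M => ?_
      simp only [Function.comp_apply, F]
      rw [Complex.ofReal_sum]
      refine Finset.sum_congr rfl fun m _ => ?_
      rw [Complex.ofReal_div, Complex.ofReal_natCast]
      congr 2
      refine Finset.sum_congr rfl fun j _ => ?_
      push_cast
      ring_nf
  let w : ZMod n → ℂ := fun j => μ j + μ (-j)
  have hw : ∀ k, ZMod.dft w k = 2 * ∑ j, (μ j * (ZMod.stdAddChar (k * j) : ℂ).re : ℝ) := by
    intro k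
    rw [ZMod.dft_apply]
    simp only [w, smul_eq_mul, mul_add, Finset.sum_add_distrib]
    rw [← Equiv.sum_comp (Equiv.neg (ZMod n)) fun j => ZMod.stdAddChar (-(j * k)) * (μ (-j) : ℂ),
      ← Finset.sum_add_distrib, Complex.ofReal_sum, Finset.mul_sum]
    refine Finset.sum_congr rfl fun j _ => ?_
    have hre := Complex.add_conj (ZMod.stdAddChar (k * j) : ℂ)
    rw [← AddChar.map_neg_eq_conj] at hre
    simp only [Equiv.neg_apply, neg_neg, neg_mul]
    rw [← add_mul, mul_comm j k, add_comm, hre]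
    push_cast
    ring
  have hw2 : ∀ k, ZMod.dft w (2 * k) = ZMod.dft w k := by
    intro k
    have hF : F k = 0 := Complex.ofReal_eq_zero.1 (congrFun hF0 k)
    rw [hw, hw, ← sub_eq_zero, ← mul_sub, ← Complex.ofReal_sub, ← Finset.sum_sub_distrib, mul_eq_zero,
      Complex.ofReal_eq_zero, ← hF]
    refine Or.inr (Finset.sum_congr rfl fun j _ => ?_)
    rw [mul_assoc]
    ring
  let u : (ZMod n)ˣ := ZMod.unitOfCoprime 2 (Nat.coprime_two_left.2 hn)
  have hu : (u : ZMod n) = 2 := by simp [u]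
  have hfix : (fun j => w (u.val * j)) = w := by
    apply ZMod.dft.injective
    funext k
    rw [ZMod.dft_comp_unitMul, ← hw2, ← hu, Units.mul_inv_cancel_left]
  have := congrFun hfix g
  simp only [w, hu] at this
  exact_mod_cast this

theorem sum_map_FS {G R : Type*} [AddCommMonoid G] [CommSemiring R] (ψ : AddChar G R)
    (A : Multiset G) : ((FS A).map ψ).sum = (A.map fun a => 1 + ψ a).prod := by
  induction A using Multiset.induction_on with
  | empty => simp [FS]
  | cons a A ih =>
    simp only [FS, Multiset.map_map, Multiset.powerset_cons, Multiset.map_add, Multiset.sum_add,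
      Multiset.map_cons, Multiset.prod_cons, Function.comp_apply, Multiset.sum_cons,
      AddChar.map_add_eq_mul, Multiset.sum_map_mul_left] at ih ⊢
    rw [ih]
    ring

theorem prod_one_add_eq_of_FS_eq {G R : Type*} [AddCommMonoid G] [CommSemiring R] {A B : Multiset G}
    {s : G} (h : FS A = (FS B).map (fun x => x + s)) (ψ : AddChar G R) :
    (A.map fun a => 1 + ψ a).prod = (B.map fun b => 1 + ψ b).prod * ψ s := by
  rw [← sum_map_FS, ← sum_map_FS, h, Multiset.map_map, ← Multiset.sum_map_mul_right]
  simp only [Function.comp_apply, AddChar.map_add_eq_mul]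

theorem sum_map_eq_sum_count_mul {G R : Type*} [Fintype G] [DecidableEq G] [Semiring R]
    (A : Multiset G) (f : G → R) : (A.map f).sum = ∑ g, (A.count g : R) * f g := by
  rw [Finset.sum_multiset_map_count]
  simp only [nsmul_eq_mul]
  refine Finset.sum_subset (Finset.subset_univ _) fun x _ hx => ?_
  rw [Multiset.count_eq_zero.2 (by simpa using hx), Nat.cast_zero, zero_mul]

theorem log_norm_prod_map {G : Type*} {f : G → ℂ} (hf : ∀ g, f g ≠ 0) (A : Multiset G) :
    Real.log ‖(A.map f).prod‖ = (A.map fun g => Real.log ‖f g‖).sum := by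
  induction A using Multiset.induction_on with
  | empty => simp
  | cons a A ih =>
    have hA : (A.map f).prod ≠ 0 := by
      simpa [Multiset.prod_eq_zero_iff] using fun g _ => hf g
    rw [Multiset.map_cons, Multiset.prod_cons, norm_mul,
      Real.log_mul (norm_ne_zero_iff.2 (hf a)) (norm_ne_zero_iff.2 hA), ih, Multiset.map_cons,
      Multiset.sum_cons]

/-- The units among the complex algebraic integers. -/
def integralUnits : Submonoid ℂ where
  carrier := {z | z ≠ 0 ∧ IsIntegral ℤ z ∧ IsIntegral ℤ z⁻¹}
  mul_mem' hx hy := ⟨mul_ne_zero hx.1 hy.1, hx.2.1.mul hy.2.1, by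
    rw [mul_inv]
    exact hx.2.2.mul hy.2.2⟩
  one_mem' := ⟨one_ne_zero, isIntegral_one, by simpa using isIntegral_one⟩

theorem mem_integralUnits_of_mul_eq_one {x y : ℂ} (hx : IsIntegral ℤ x) (hy : IsIntegral ℤ y)
    (h : x * y = 1) : x ∈ integralUnits :=
  ⟨left_ne_zero_of_mul_eq_one h, hx, by rwa [← eq_inv_of_mul_eq_one_right h]⟩

theorem mem_integralUnits_of_pow_eq_one {z : ℂ} {n : ℕ} (hn : n ≠ 0) (hz : z ^ n = 1) :
    z ∈ integralUnits := by
  have hi : IsIntegral ℤ z := .of_pow (Nat.pos_of_ne_zero hn) (hz ▸ isIntegral_one)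
  exact mem_integralUnits_of_mul_eq_one hi (hi.pow (n - 1)) (by rw [mul_pow_sub_one hn, hz])

theorem one_add_mem_integralUnits {z : ℂ} {n : ℕ} (hn : Odd n) (hz : z ^ n = 1) (h1 : z ≠ 1) :
    1 + z ∈ integralUnits := by
  have hi : IsIntegral ℤ z := .of_pow hn.pos (hz ▸ isIntegral_one)
  obtain ⟨t, rfl⟩ := hn
  refine mem_integralUnits_of_mul_eq_one (y := ∑ i ∈ Finset.range (t + 1), (z ^ 2) ^ i)
    (isIntegral_one.add hi) (.sum _ fun i _ => (hi.pow 2).pow i) ?_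
  have hg := geom_sum_mul (z ^ 2) (t + 1)
  have hp : (z ^ 2) ^ (t + 1) = z := by
    rw [← pow_mul, mul_add, mul_one, show 2 * t + 2 = 2 * t + 1 + 1 from rfl, pow_succ, hz, one_mul]
  rw [hp] at hg
  refine mul_right_cancel₀ (sub_ne_zero.2 h1) ?_
  rw [one_mul]
  linear_combination hg

theorem le_of_two_pow_mul_eq {a b : ℕ} {u v : ℂ} (hu : u ∈ integralUnits) (hv : v ∈ integralUnits)
    (h : 2 ^ a * u = 2 ^ b * v) : a ≤ b := by
  by_contra! hab
  obtain ⟨d, rfl⟩ := Nat.exists_eq_add_of_lt hab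
  have h1 : (2 : ℂ) ^ (d + 1) * (u * v⁻¹) = 1 := by
    have hb : (2 : ℂ) ^ b ≠ 0 := pow_ne_zero _ two_ne_zero
    have hv0 : v ≠ 0 := hv.1
    field_simp
    refine mul_left_cancel₀ hb ?_
    rw [← h]
    ring
  have hi : IsIntegral ℤ (algebraMap ℚ ℂ ((2 ^ (d + 1))⁻¹)) := by
    have : algebraMap ℚ ℂ ((2 ^ (d + 1))⁻¹) = u * v⁻¹ := by
      rw [map_inv₀, map_pow, map_ofNat, eq_comm]
      exact eq_inv_of_mul_eq_one_right h1
    rw [this]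
    exact hu.2.1.mul hv.2.2
  rw [isIntegral_algebraMap_iff (algebraMap ℚ ℂ).injective] at hi
  obtain ⟨y, hy⟩ := IsIntegrallyClosed.isIntegral_iff.1 hi
  have h2 : (2 : ℤ) ^ (d + 1) * y = 1 := by
    have : (2 : ℚ) ^ (d + 1) * y = 1 := by
      rw [show (y : ℚ) = _ from hy]
      exact mul_inv_cancel₀ (by positivity)
    exact_mod_cast this
  rw [pow_succ', mul_assoc] at h2
  omega

theorem exists_prod_one_add_eq {n : ℕ} [NeZero n] (hn : Odd n) (k : ZMod n)
    (A : Multiset (ZMod n)) : ∃ u ∈ integralUnits,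
      (A.map fun a => (1 : ℂ) + ZMod.stdAddChar (k * a)).prod =
        2 ^ (A.map fun a => if k * a = 0 then 1 else 0).sum * u := by
  induction A using Multiset.induction_on with
  | empty => exact ⟨1, one_mem _, by simp⟩
  | cons a A ih =>
    obtain ⟨u, hu, h⟩ := ih
    by_cases ha : k * a = 0
    · refine ⟨u, hu, ?_⟩
      rw [Multiset.map_cons, Multiset.prod_cons, h, Multiset.map_cons, Multiset.sum_cons, if_pos ha,
        ha, AddChar.map_zero_eq_one, pow_add]
      ring
    · refine ⟨(1 + ZMod.stdAddChar (k * a)) * u, mul_mem (one_add_mem_integralUnits hn ?_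
        (mt stdAddChar_eq_one_iff.1 ha)) hu, ?_⟩
      · rw [← AddChar.map_nsmul_eq_pow, nsmul_eq_mul, ZMod.natCast_self, zero_mul,
          AddChar.map_zero_eq_one]
      · rw [Multiset.map_cons, Multiset.prod_cons, h, Multiset.map_cons, Multiset.sum_cons,
          if_neg ha, zero_add]
        ring

theorem log_norm_one_add_stdAddChar {n : ℕ} [NeZero n] (hn : Odd n) (x : ZMod n) :
    Real.log ‖(1 : ℂ) + ZMod.stdAddChar x‖ =
      Real.log ‖(1 : ℂ) - ZMod.stdAddChar (2 * x)‖ - Real.log ‖(1 : ℂ) - ZMod.stdAddChar x‖ +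
        Real.log 2 * if x = 0 then 1 else 0 := by
  by_cases hx : x = 0
  · simp [hx, one_add_one_eq_two]
  · have h1 : (1 : ℂ) - ZMod.stdAddChar x ≠ 0 :=
      sub_ne_zero.2 fun h => hx (stdAddChar_eq_one_iff.1 h.symm)
    have h2 : (1 : ℂ) - ZMod.stdAddChar (2 * x) ≠ 0 :=
      sub_ne_zero.2 fun h => hx ((two_mul_eq_zero_iff_of_odd hn).1 (stdAddChar_eq_one_iff.1 h.symm))
    have h3 : (1 : ℂ) - ZMod.stdAddChar (2 * x) =
        (1 + ZMod.stdAddChar x) * (1 - ZMod.stdAddChar x) := by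
      rw [two_mul, AddChar.map_add_eq_mul]
      ring
    rw [h3] at h2 ⊢
    rw [norm_mul, Real.log_mul (norm_ne_zero_iff.2 (left_ne_zero_of_mul h2))
      (norm_ne_zero_iff.2 h1), if_neg hx]
    ring

theorem exists_forall_mem_iff_mul_eq_zero {n : ℕ} [NeZero n] (H : AddSubgroup (ZMod n)) :
    ∃ k : ZMod n, ∀ x, x ∈ H ↔ k * x = 0 := by
  classical
  refine ⟨(Nat.card H : ZMod n), ?_⟩
  have hsub : (Finset.univ.filter fun x => x ∈ H) ⊆
      Finset.univ.filter fun x : ZMod n => Nat.card H • x = 0 := by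
    intro x hx
    simp only [Finset.mem_filter, Finset.mem_univ, true_and] at hx ⊢
    exact congrArg Subtype.val (card_nsmul_eq_zero' (x := (⟨x, hx⟩ : H)))
  have hcard : (Finset.univ.filter fun x => x ∈ H).card = Nat.card H := by
    rw [Nat.card_eq_fintype_card, Fintype.card_subtype]
  have := Finset.eq_of_subset_of_card_le hsub
    (by
    rw [hcard]
    exact IsAddCyclic.card_nsmul_eq_zero_le Nat.card_pos)
  intro x
  simpa [nsmul_eq_mul] using Finset.ext_iff.1 this x

theorem stmt13 (n : ℕ) (hn : Odd n) (A B : Multiset (ZMod n)) (s : ZMod n)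
    (h : FS A = (FS B).map (fun x => x + s)) :
    memV (fun g : ZMod n => (A.count g : ℤ) - (B.count g : ℤ)) := by
  have : NeZero n := ⟨hn.pos.ne'⟩
  have hprod : ∀ k : ZMod n, (A.map fun a => (1 : ℂ) + ZMod.stdAddChar (k * a)).prod =
      (B.map fun b => (1 : ℂ) + ZMod.stdAddChar (k * b)).prod * ZMod.stdAddChar (k * s) :=
    fun k => prod_one_add_eq_of_FS_eq h (AddChar.mulShift ZMod.stdAddChar k)
  have hroot : ∀ x : ZMod n, (ZMod.stdAddChar x : ℂ) ^ n = 1 := fun x => by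
    rw [← AddChar.map_nsmul_eq_pow, nsmul_eq_mul, ZMod.natCast_self, zero_mul,
      AddChar.map_zero_eq_one]
  have hker : ∀ k : ZMod n,
      ∑ g, ((A.count g : ℤ) - (B.count g : ℤ)) * (if k * g = 0 then 1 else 0) = 0 := by
    intro k
    obtain ⟨u, hu, hA⟩ := exists_prod_one_add_eq hn k A
    obtain ⟨v, hv, hB⟩ := exists_prod_one_add_eq hn k B
    have hv' := mul_mem hv (mem_integralUnits_of_pow_eq_one hn.pos.ne' (hroot (k * s)))
    have e := hprod k
    rw [hA, hB, mul_assoc] at e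
    have e' := le_antisymm (le_of_two_pow_mul_eq hu hv' e) (le_of_two_pow_mul_eq hv' hu e.symm)
    rw [sum_map_eq_sum_count_mul, sum_map_eq_sum_count_mul] at e'
    simp only [sub_mul, Finset.sum_sub_distrib, sub_eq_zero]
    exact_mod_cast e'
  refine ⟨Set.toFinite _, fun g => ?_, fun H => ?_⟩
  · have hne : ∀ x : ZMod n, (1 : ℂ) + ZMod.stdAddChar x ≠ 0 := by
      intro x hx
      have hx' := hroot x
      rw [eq_neg_of_add_eq_zero_right hx, hn.neg_one_pow] at hx'
      norm_num at hx'
    have := even_part_comp_two_mul_eq hn (fun g => (A.count g : ℝ) - (B.count g : ℝ))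
      (fun k => ?_) g
    · rw [← two_mul]
      exact_mod_cast this.symm
    · have e := congrArg (fun z => Real.log ‖z‖) (hprod k)
      simp only [norm_mul, norm_stdAddChar, mul_one] at e
      rw [log_norm_prod_map fun g => hne (k * g), log_norm_prod_map fun g => hne (k * g),
        sum_map_eq_sum_count_mul, sum_map_eq_sum_count_mul] at e
      have e2 := congrArg (fun z : ℤ => Real.log 2 * (z : ℝ)) (hker k)
      push_cast at e2
      rw [mul_zero, Finset.mul_sum] at e2
      simp only [log_norm_one_add_stdAddChar hn] at e
      rw [← sub_eq_zero, ← Finset.sum_sub_distrib] at e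
      rw [← add_zero (∑ j, _), ← e2, ← Finset.sum_add_distrib, e2]
      refine (Finset.sum_congr rfl fun x _ => ?_).trans e
      ring
  · obtain ⟨k, hk⟩ := exists_forall_mem_iff_mul_eq_zero H
    rw [finsum_mem_def, finsum_eq_sum_of_fintype, ← hker k]
    refine Finset.sum_congr rfl fun g _ => ?_
    by_cases hg : k * g = 0
    · rw [Set.indicator_of_mem ((hk g).2 hg), if_pos hg, mul_one]
    · rw [Set.indicator_of_notMem (mt (hk g).1 hg), if_neg hg, mul_zero]
end

section
/- Let G be an abelian group with no elements of order 2. Suppose that for all finite multisets A, B of G and all s ∈ G, FS(A) = FS(B) + s implies μ_A − μ_B ∈ V(G). Then for all finite multisets A, B of the direct sum G ⊕ ℤ and all s ∈ G ⊕ ℤ, FS(A) = FS(B) + s implies μ_A − μ_B ∈ V(G ⊕ ℤ). -/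
open scoped BigOperators

lemma FS_zero {G : Type*} [AddCommMonoid G] : FS (0 : Multiset G) = {0} := by
  simp [FS]

lemma FS_cons {G : Type*} [AddCommMonoid G] (a : G) (A : Multiset G) :
    FS (a ::ₘ A) = FS A + (FS A).map (fun x => a + x) := by
  simp [FS, Multiset.powerset_cons, Multiset.map_map]

lemma mem_FS {G : Type*} [AddCommMonoid G] {A : Multiset G} {x : G} :
    x ∈ FS A ↔ ∃ S ≤ A, S.sum = x := by
  simp [FS]

lemma FS_map {G K : Type*} [AddCommMonoid G] [AddCommMonoid K] (f : G →+ K) (A : Multiset G) :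
    FS (A.map f) = (FS A).map f := by
  induction A using Multiset.induction_on with
  | empty => simp [FS_zero]
  | cons a A ih => simp [FS_cons, ih, Multiset.map_map]

lemma FS_add_right {G : Type*} [AddCommMonoid G] {A B : Multiset G} {s : G}
    (h : FS A = (FS B).map (fun x => x + s)) (C : Multiset G) :
    FS (C + A) = (FS (C + B)).map (fun x => x + s) := by
  induction C using Multiset.induction_on with
  | empty => simpa using h
  | cons c C ih =>
    simp [FS_cons, ih, Multiset.map_map, add_assoc]

/-- Without 2-torsion, a finitely supported function with `f (g + a) = - f g` vanishes. -/
lemma eq_zero_of_antiperiodic {G : Type*} [AddCommGroup G] (h2 : ∀ g : G, g + g = 0 → g = 0)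
    {f : G → ℤ} (hf : (Function.support f).Finite) {a : G} (h : ∀ g, f (g + a) = - f g) (g : G) :
    f g = 0 := by
  by_contra hg
  have hk : ∀ k : ℕ, f (g + k • a) = (-1) ^ k * f g := by
    intro k
    induction k with
    | zero => simp
    | succ k ih => rw [succ_nsmul, ← add_assoc, h, ih]; ring
  have hfin : IsOfFinAddOrder a := by
    by_contra hinf
    have hinj := injective_nsmul_iff_not_isOfFinAddOrder.2 hinf
    refine Set.infinite_of_injective_forall_mem (s := Function.support f)
      (f := fun k : ℕ => g + k • a) (fun i j hij => hinj (add_left_cancel hij)) ?_ hf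
    intro k
    simp [hk, hg]
  have hpos : 0 < addOrderOf a := hfin.addOrderOf_pos
  have hm : f g = (-1) ^ addOrderOf a * f g := by
    rw [← hk, addOrderOf_nsmul_eq_zero, add_zero]
  rcases Nat.even_or_odd (addOrderOf a) with ⟨j, hj⟩ | ho
  · have h0 : j • a = 0 := h2 _ (by rw [← add_nsmul, ← hj, addOrderOf_nsmul_eq_zero])
    have := addOrderOf_le_of_nsmul_eq_zero (by omega) h0
    omega
  · rw [ho.neg_one_pow] at hm
    omega

lemma support_count_sub_count_finite {G : Type*} [DecidableEq G] (A B : Multiset G) :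
    (Function.support fun g => (A.count g : ℤ) - (B.count g : ℤ)).Finite := by
  refine (A + B).toFinset.finite_toSet.subset fun g hg => ?_
  by_contra hn
  simp only [Finset.mem_coe, Multiset.mem_toFinset, Multiset.mem_add, not_or] at hn
  simp [Multiset.count_eq_zero_of_notMem hn.1, Multiset.count_eq_zero_of_notMem hn.2] at hg

lemma add_map_add_left_cancel {G : Type*} [AddCommGroup G] (h2 : ∀ g : G, g + g = 0 → g = 0)
    {E F : Multiset G} {a : G}
    (h : E + E.map (fun x => a + x) = F + F.map (fun x => a + x)) : E = F := by
  classical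
  have hc : ∀ (S : Multiset G) (g : G),
      (S + S.map (fun x => a + x)).count (g + a) = S.count (g + a) + S.count g := by
    intro S g
    rw [Multiset.count_add, add_comm g a,
      Multiset.count_map_eq_count' (fun x => a + x) S (add_right_injective a)]
  ext g
  have := eq_zero_of_antiperiodic h2 (support_count_sub_count_finite E F) (a := a) (fun g => by
    have h1 := hc E g
    rw [h, hc F g] at h1
    omega) g
  omega

lemma FS_add_left_cancel {G : Type*} [AddCommGroup G] (h2 : ∀ g : G, g + g = 0 → g = 0)
    {A B : Multiset G} (C : Multiset G) (h : FS (C + A) = FS (C + B)) : FS A = FS B := by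
  induction C using Multiset.induction_on with
  | empty => simpa using h
  | cons c C ih =>
    rw [Multiset.cons_add, Multiset.cons_add, FS_cons, FS_cons] at h
    exact ih (add_map_add_left_cancel h2 h)

lemma snd_nonneg_of_mem_FS {G : Type*} [AddCommGroup G] {A : Multiset (G × ℤ)}
    (hA : ∀ a ∈ A, 0 ≤ a.2) {x : G × ℤ} (hx : x ∈ FS A) : 0 ≤ x.2 := by
  induction A using Multiset.induction_on generalizing x with
  | empty => simp_all [FS_zero]
  | cons a A ih =>
    have hA' : ∀ b ∈ A, 0 ≤ b.2 := fun b hb => hA b (Multiset.mem_cons_of_mem hb)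
    rw [FS_cons, Multiset.mem_add, Multiset.mem_map] at hx
    rcases hx with hx | ⟨y, hy, rfl⟩
    · exact ih hA' hx
    · exact add_nonneg (hA a (Multiset.mem_cons_self a A)) (ih hA' hy)

/-- A subset sum of elements of height at least `m > 0` whose height is `m` is an element. -/
lemma mem_of_mem_FS_of_snd_le {G : Type*} [AddCommGroup G] {A : Multiset (G × ℤ)} {m : ℤ}
    (hm : 0 < m) (hA : ∀ a ∈ A, m ≤ a.2) {x : G × ℤ} (hx : x ∈ FS A) (hx2 : x.2 = m) :
    x ∈ A := by
  obtain ⟨S, hS, rfl⟩ := mem_FS.1 hx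
  rcases S.empty_or_exists_mem with rfl | ⟨a, ha⟩
  · simp at hx2; omega
  · obtain ⟨T, rfl⟩ := Multiset.exists_cons_of_mem ha
    rcases T.empty_or_exists_mem with rfl | ⟨b, hb⟩
    · simpa using Multiset.mem_of_le hS ha
    · obtain ⟨U, rfl⟩ := Multiset.exists_cons_of_mem hb
      have h1 := hA a (Multiset.mem_of_le hS ha)
      have h3 := hA b (Multiset.mem_of_le hS (Multiset.mem_cons_of_mem hb))
      have h4 : 0 ≤ U.sum.2 := by
        refine snd_nonneg_of_mem_FS (A := U) (fun u hu => hm.le.trans (hA u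
          (Multiset.mem_of_le hS (Multiset.mem_cons_of_mem (Multiset.mem_cons_of_mem hu))))) ?_
        exact mem_FS.2 ⟨U, le_rfl, rfl⟩
      simp only [Multiset.sum_cons, Prod.snd_add] at hx2
      omega

lemma mem_FS_of_mem {G : Type*} [AddCommMonoid G] {A : Multiset G} {a : G} (ha : a ∈ A) :
    a ∈ FS A :=
  mem_FS.2 ⟨{a}, Multiset.singleton_le.2 ha, by simp⟩

lemma zero_mem_FS {G : Type*} [AddCommMonoid G] (A : Multiset G) : 0 ∈ FS A :=
  mem_FS.2 ⟨0, Multiset.zero_le A, by simp⟩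

lemma FS_injOn_snd_pos {G : Type*} [AddCommGroup G] (h2 : ∀ g : G × ℤ, g + g = 0 → g = 0)
    (n : ℕ) : ∀ {A B : Multiset (G × ℤ)}, (A + B).card ≤ n → (∀ a ∈ A, 0 < a.2) →
      (∀ b ∈ B, 0 < b.2) → FS A = FS B → A = B := by
  induction n with
  | zero =>
    intro A B hn _ _ _
    simp at hn
    rw [hn.1, hn.2]
  | succ n ih =>
    intro A B hn hA hB h
    rcases (A + B).empty_or_exists_mem with h0 | ⟨c, hc⟩
    · simp at h0
      rw [h0.1, h0.2]
    · classical
      obtain ⟨a, ha, hmin⟩ := (A + B).toFinset.exists_min_image Prod.snd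
        ⟨c, Multiset.mem_toFinset.2 hc⟩
      simp only [Multiset.mem_toFinset, Multiset.mem_add] at ha hmin
      have hpos : 0 < a.2 := ha.elim (hA a) (hB a)
      have haFS : a ∈ FS A := by
        rcases ha with ha | ha
        · exact mem_FS_of_mem ha
        · exact h ▸ mem_FS_of_mem ha
      have haA := mem_of_mem_FS_of_snd_le hpos (fun x hx => hmin x (.inl hx)) haFS rfl
      have haB := mem_of_mem_FS_of_snd_le hpos (fun x hx => hmin x (.inr hx)) (h ▸ haFS) rfl
      obtain ⟨A, rfl⟩ := Multiset.exists_cons_of_mem haA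
      obtain ⟨B, rfl⟩ := Multiset.exists_cons_of_mem haB
      rw [FS_cons, FS_cons] at h
      simp only [Multiset.card_add, Multiset.card_cons] at hn
      rw [ih (by rw [Multiset.card_add]; omega)
        (fun x hx => hA x (Multiset.mem_cons_of_mem hx))
        (fun x hx => hB x (Multiset.mem_cons_of_mem hx)) (add_map_add_left_cancel h2 h)]

/-- Replace `a` by `-a` if its height is negative. -/
def flipUp {G : Type*} [AddCommGroup G] (a : G × ℤ) : G × ℤ := if a.2 < 0 then -a else a

lemma flipUp_snd_nonneg {G : Type*} [AddCommGroup G] (a : G × ℤ) : 0 ≤ (flipUp a).2 := by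
  unfold flipUp
  split_ifs with h
  · simp only [Prod.snd_neg]; omega
  · omega

lemma exists_FS_map_flipUp {G : Type*} [AddCommGroup G] (A : Multiset (G × ℤ)) :
    ∃ t, FS (A.map flipUp) = (FS A).map (fun x => x + t) := by
  induction A using Multiset.induction_on with
  | empty => exact ⟨0, by simp [FS_zero]⟩
  | cons a A ih =>
    obtain ⟨t, ht⟩ := ih
    rw [Multiset.map_cons]
    by_cases ha : a.2 < 0
    · refine ⟨-a + t, ?_⟩
      rw [show flipUp a = -a from if_pos ha, FS_cons, FS_cons, ht, add_comm]
      simp only [Multiset.map_add, Multiset.map_map, Function.comp_def]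
      congr 1
      · exact Multiset.map_congr rfl fun x _ => by abel
      · exact Multiset.map_congr rfl fun x _ => by abel
    · refine ⟨t, ?_⟩
      rw [show flipUp a = a from if_neg ha, FS_cons, FS_cons, ht]
      simp [Multiset.map_map, add_assoc]

lemma count_map_flipUp_of_pos {G : Type*} [AddCommGroup G] [DecidableEq G]
    (A : Multiset (G × ℤ)) {x : G × ℤ} (hx : 0 < x.2) :
    (A.map flipUp).count x = A.count x + A.count (-x) := by
  induction A using Multiset.induction_on with
  | empty => simp
  | cons a A ih =>
    rw [Multiset.map_cons, Multiset.count_cons, Multiset.count_cons, Multiset.count_cons, ih]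
    by_cases ha : a.2 < 0
    · have h1 : x ≠ a := by rintro rfl; omega
      have h3 : x = flipUp a ↔ -x = a := by
        rw [flipUp, if_pos ha]; exact eq_neg_iff_add_eq_zero.trans neg_eq_iff_add_eq_zero.symm
      simp only [h1, h3, if_false]
      omega
    · have h1 : -x ≠ a := by
        rintro rfl; simp only [Prod.snd_neg] at ha; omega
      rw [show flipUp a = a from if_neg ha]
      simp only [h1, if_false]
      omega

lemma count_map_flipUp_of_eq_zero {G : Type*} [AddCommGroup G] [DecidableEq G]
    (A : Multiset (G × ℤ)) {x : G × ℤ} (hx : x.2 = 0) :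
    (A.map flipUp).count x = A.count x := by
  induction A using Multiset.induction_on with
  | empty => simp
  | cons a A ih =>
    rw [Multiset.map_cons, Multiset.count_cons, Multiset.count_cons, ih]
    by_cases ha : a.2 < 0
    · have h1 : x ≠ a := by rintro rfl; omega
      have h3 : x ≠ flipUp a := by
        rw [flipUp, if_pos ha]; rintro rfl; simp only [Prod.snd_neg] at hx; omega
      simp only [h1, h3, if_false]
    · rw [show flipUp a = a from if_neg ha]

lemma filter_FS {G : Type*} [AddCommGroup G] {A : Multiset (G × ℤ)} (hA : ∀ a ∈ A, 0 ≤ a.2) :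
    (FS A).filter (fun x => x.2 = 0) = FS (A.filter fun x => x.2 = 0) := by
  induction A using Multiset.induction_on with
  | empty => simp [FS_zero, Multiset.filter_singleton]
  | cons a A ih =>
    have hA' : ∀ b ∈ A, 0 ≤ b.2 := fun b hb => hA b (Multiset.mem_cons_of_mem hb)
    have ha := hA a (Multiset.mem_cons_self a A)
    rw [FS_cons, Multiset.filter_add, ih hA', Multiset.filter_map]
    by_cases h0 : a.2 = 0
    · rw [Multiset.filter_cons_of_pos (p := fun x : G × ℤ => x.2 = 0) _ h0, FS_cons, ← ih hA']
      simp [h0]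
    · rw [Multiset.filter_cons_of_neg (p := fun x : G × ℤ => x.2 = 0) _ h0, add_eq_left,
        Multiset.map_eq_zero, Multiset.filter_eq_nil]
      intro x hx
      have := snd_nonneg_of_mem_FS hA' hx
      simp only [Function.comp_apply, Prod.snd_add]
      omega

lemma count_map_fst_filter {G : Type*} [DecidableEq G] (A : Multiset (G × ℤ)) (g : G) :
    ((A.filter fun x => x.2 = 0).map Prod.fst).count g = A.count (g, 0) := by
  induction A using Multiset.induction_on with
  | empty => simp
  | cons a A ih =>
    obtain ⟨h, n⟩ := a
    by_cases h0 : n = 0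
    · subst h0
      simp [Multiset.count_cons, ih]
    · rw [Multiset.filter_cons_of_neg (p := fun x : G × ℤ => x.2 = 0) _ h0, ih,
        Multiset.count_cons_of_ne]
      simp [Ne.symm h0]

/-- A function on `G × ℤ` that restricts to an element of `V(G)` and is odd away from `G × {0}`
belongs to `V(G × ℤ)`. -/
lemma memV_prod_int {G : Type*} [AddCommGroup G] {μ : G × ℤ → ℤ}
    (hfin : (Function.support μ).Finite) (h0 : memV fun g => μ (g, 0))
    (hodd : ∀ x : G × ℤ, x.2 ≠ 0 → μ x + μ (-x) = 0) : memV μ := by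
  refine ⟨hfin, ?_, fun H => ?_⟩
  · rintro ⟨g, n⟩
    by_cases hn : n = 0
    · subst hn
      simpa using h0.2.1 g
    · rw [hodd _ hn, hodd]
      simp only [Prod.snd_add]
      omega
  · rw [← finsum_mem_inter_add_sdiff' {x : G × ℤ | x.2 = 0} (hfin.subset Set.inter_subset_right)]
    have hzero : (H : Set (G × ℤ)) ∩ {x | x.2 = 0} =
        (fun g : G => (g, (0 : ℤ))) '' (H.comap (AddMonoidHom.inl G ℤ) : Set G) := by
      ext ⟨g, n⟩
      simp only [Set.mem_inter_iff, Set.mem_ofPred_eq, Set.mem_image, SetLike.mem_coe,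
        AddSubgroup.mem_comap, AddMonoidHom.inl_apply, Prod.mk.injEq]
      constructor
      · rintro ⟨h, rfl⟩
        exact ⟨g, h, rfl, rfl⟩
      · rintro ⟨_, h, rfl, rfl⟩
        exact ⟨h, rfl⟩
    have hinj : Function.Injective fun g : G => (g, (0 : ℤ)) := fun _ _ h => congrArg Prod.fst h
    rw [hzero, finsum_mem_image hinj.injOn, h0.2.2, zero_add]
    set S : Set (G × ℤ) := (H : Set (G × ℤ)) \ {x | x.2 = 0} with hS
    have hneg : (fun x : G × ℤ => -x) '' S = S := by
      ext x
      simp [hS]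
    have h1 : ∑ᶠ x ∈ S, μ x = ∑ᶠ x ∈ S, -μ x := by
      conv_lhs => rw [← hneg]
      rw [finsum_mem_image neg_injective.injOn]
      refine finsum_mem_congr rfl fun x hx => ?_
      have := hodd x hx.2
      omega
    rw [finsum_mem_def, finsum_mem_def, Set.indicator_neg, finsum_neg_distrib, ← finsum_mem_def]
      at h1
    omega

theorem stmt17 {G : Type*} [AddCommGroup G] [DecidableEq G]
    (h2 : ∀ g : G, g + g = 0 → g = 0)
    (hG : ∀ (A B : Multiset G) (s : G), FS A = (FS B).map (fun x => x + s) →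
      memV (fun g => (A.count g : ℤ) - (B.count g : ℤ))) :
    ∀ (A B : Multiset (G × ℤ)) (s : G × ℤ), FS A = (FS B).map (fun x => x + s) →
      memV (fun g : G × ℤ => (A.count g : ℤ) - (B.count g : ℤ)) := by
  intro A B s h
  have h2' : ∀ g : G × ℤ, g + g = 0 → g = 0 := by
    rintro ⟨g, n⟩ hg
    simp only [Prod.mk_add_mk, Prod.mk_eq_zero] at hg ⊢
    exact ⟨h2 g hg.1, by omega⟩
  obtain ⟨t, ht⟩ := exists_FS_map_flipUp A
  obtain ⟨u, hu⟩ := exists_FS_map_flipUp B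
  set A' := A.map flipUp with hA'
  set B' := B.map flipUp with hB'
  have hApos : ∀ a ∈ A', 0 ≤ a.2 := by
    intro a ha
    obtain ⟨b, -, rfl⟩ := Multiset.mem_map.1 ha
    exact flipUp_snd_nonneg b
  have hBpos : ∀ a ∈ B', 0 ≤ a.2 := by
    intro a ha
    obtain ⟨b, -, rfl⟩ := Multiset.mem_map.1 ha
    exact flipUp_snd_nonneg b
  obtain ⟨r, hr⟩ : ∃ r, FS A' = (FS B').map (fun x => x + r) := by
    refine ⟨s + t - u, ?_⟩
    rw [ht, hu, h, Multiset.map_map, Multiset.map_map]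
    exact Multiset.map_congr rfl fun x _ => by simp only [Function.comp_apply]; abel
  have hr2 : r.2 = 0 := by
    have hle : 0 ≤ r.2 := by
      refine snd_nonneg_of_mem_FS hApos ?_
      rw [hr]
      exact Multiset.mem_map.2 ⟨0, zero_mem_FS B', zero_add r⟩
    obtain ⟨x, hx, hxr⟩ := Multiset.mem_map.1 (hr ▸ zero_mem_FS A')
    have hx2 := snd_nonneg_of_mem_FS hBpos hx
    have := congrArg Prod.snd hxr
    simp only [Prod.snd_add, Prod.snd_zero] at this
    omega
  have hr0 : FS (A'.filter fun x => x.2 = 0) =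
      (FS (B'.filter fun x => x.2 = 0)).map (fun x => x + r) := by
    rw [← filter_FS hApos, ← filter_FS hBpos, hr, Multiset.filter_map]
    simp [hr2]
  have hpos : (A'.filter fun x => ¬ x.2 = 0) = B'.filter fun x => ¬ x.2 = 0 := by
    refine FS_injOn_snd_pos h2' _ le_rfl ?_ ?_ ?_
    · intro a ha
      rw [Multiset.mem_filter] at ha
      exact lt_of_le_of_ne (hApos a ha.1) (Ne.symm ha.2)
    · intro a ha
      rw [Multiset.mem_filter] at ha
      exact lt_of_le_of_ne (hBpos a ha.1) (Ne.symm ha.2)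
    · refine FS_add_left_cancel h2' (A'.filter fun x => x.2 = 0) ?_
      rw [Multiset.filter_add_not, hr, add_comm, FS_add_right hr0, add_comm,
        Multiset.filter_add_not]
  have hV := hG ((A'.filter fun x => x.2 = 0).map Prod.fst)
    ((B'.filter fun x => x.2 = 0).map Prod.fst) r.1 (by
      have hA0 := FS_map (AddMonoidHom.fst G ℤ) (A'.filter fun x => x.2 = 0)
      have hB0 := FS_map (AddMonoidHom.fst G ℤ) (B'.filter fun x => x.2 = 0)
      simp only [AddMonoidHom.coe_fst] at hA0 hB0
      rw [hA0, hB0, hr0]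
      simp [Multiset.map_map])
  simp only [count_map_fst_filter, hA', hB', count_map_flipUp_of_eq_zero] at hV
  have key : ∀ x : G × ℤ, 0 < x.2 →
      A.count x + A.count (-x) = B.count x + B.count (-x) := by
    intro x hx
    rw [← count_map_flipUp_of_pos A hx, ← count_map_flipUp_of_pos B hx]
    have := congrArg (Multiset.count x) hpos
    rwa [Multiset.count_filter_of_pos (p := fun x : G × ℤ => ¬ x.2 = 0) hx.ne',
      Multiset.count_filter_of_pos (p := fun x : G × ℤ => ¬ x.2 = 0) hx.ne'] at this
  refine memV_prod_int (support_count_sub_count_finite A B) hV fun x hx => ?_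
  rcases lt_or_gt_of_ne hx with hx | hx
  · have := key (-x) (by simpa using hx)
    rw [neg_neg] at this
    omega
  · have := key x hx
    omega
end
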